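/- Let $K$ be a field and $n$ a positive integer such that either ($n\geq 4$ and $\mathrm{char}\,K\neq 3$) or $n\geq 5$. Then every Chein automorphism of the free metabelian Lie algebra $M_n$ of lower degree $\geq 4$ is tame. -/

import Mathlib

noncomputable section

/-- The free metabelian Lie algebra of rank `n` over `K`: the quotient of the free Lie
algebra on `n` generators by its second derived ideal. -/
abbrev FreeMetabelianLie (K : Type) [Field K] (n : ℕ) : Type :=
  FreeLieAlgebra K (Fin n) ⧸ LieAlgebra.derivedSeries K (FreeLieAlgebra K (Fin n)) 2

/-- The free generators `x₁, …, xₙ` of the free metabelian Lie algebra. -/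
def xg (K : Type) [Field K] (n : ℕ) (i : Fin n) : FreeMetabelianLie K n :=
  LieSubmodule.Quotient.mk (N := LieAlgebra.derivedSeries K (FreeLieAlgebra K (Fin n)) 2)
    (FreeLieAlgebra.of K i)

/-- The group structure on Lie algebra automorphisms, with `(e * f) x = e (f x)`. -/
instance lieAutGroup (K : Type) [CommRing K] (L : Type) [LieRing L] [LieAlgebra K L] :
    Group (L ≃ₗ⁅K⁆ L) where
  mul e f := f.trans e
  one := LieEquiv.refl
  inv := LieEquiv.symm
  mul_assoc _ _ _ := LieEquiv.ext fun _ => rfl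
  one_mul _ := LieEquiv.ext fun _ => rfl
  mul_one _ := LieEquiv.ext fun _ => rfl
  inv_mul_cancel e := LieEquiv.ext fun x => e.symm_apply_apply x

/-- An automorphism of the free metabelian Lie algebra is elementary if it maps some `xᵢ` to
`α • xᵢ + f`, with `0 ≠ α ∈ K` and `f` in the subalgebra generated by the other generators,
and fixes all other generators. -/
def IsElementaryAut (K : Type) [Field K] (n : ℕ)
    (φ : FreeMetabelianLie K n ≃ₗ⁅K⁆ FreeMetabelianLie K n) : Prop :=
  ∃ (i : Fin n) (α : K) (f : FreeMetabelianLie K n), α ≠ 0 ∧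
    f ∈ LieSubalgebra.lieSpan K (FreeMetabelianLie K n) (xg K n '' {j | j ≠ i}) ∧
    φ (xg K n i) = α • xg K n i + f ∧ ∀ j : Fin n, j ≠ i → φ (xg K n j) = xg K n j

/-- A tame automorphism is one in the subgroup generated by the elementary automorphisms. -/
def IsTame (K : Type) [Field K] (n : ℕ)
    (φ : FreeMetabelianLie K n ≃ₗ⁅K⁆ FreeMetabelianLie K n) : Prop :=
  φ ∈ Subgroup.closure {ψ | IsElementaryAut K n ψ}

/-- A Chein automorphism (one-row transformation) moves only one generator. -/
def IsCheinAut (K : Type) [Field K] (n : ℕ)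
    (φ : FreeMetabelianLie K n ≃ₗ⁅K⁆ FreeMetabelianLie K n) : Prop :=
  ∃ i : Fin n, ∀ j : Fin n, j ≠ i → φ (xg K n j) = xg K n j

/-- An almost tame automorphism is one in the subgroup generated by Chein automorphisms. -/
def IsAlmostTame (K : Type) [Field K] (n : ℕ)
    (φ : FreeMetabelianLie K n ≃ₗ⁅K⁆ FreeMetabelianLie K n) : Prop :=
  φ ∈ Subgroup.closure {ψ | IsCheinAut K n ψ}

/-- `monoSet K n k` is the set of right-normed Lie monomials of degree `k+1` in the
generators. -/
def monoSet (K : Type) [Field K] (n : ℕ) : ℕ → Set (FreeMetabelianLie K n)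
  | 0 => Set.range (xg K n)
  | k + 1 => {z | ∃ u ∈ monoSet K n k, ∃ i : Fin n, z = ⁅u, xg K n i⁆}

/-- `gradePiece K n k` (for `k ≥ 1`) is the homogeneous component `L_k` of the standard
grading: the linear span of the Lie monomials of degree `k` in the generators. -/
def gradePiece (K : Type) [Field K] (n : ℕ) (k : ℕ) : Submodule K (FreeMetabelianLie K n) :=
  Submodule.span K (monoSet K n (k - 1))

/-- The automorphism `φ = (l₁ + m₁, …, lₙ + mₙ)` (with `lᵢ` linear, `mᵢ ∈ [M,M]`) has lower
degree `≥ d`: each `φ(xᵢ)` lies in `L₁ ⊕ (⨆ k ≥ d, L_k)`. -/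
def AutLdegGE (K : Type) [Field K] (n : ℕ)
    (φ : FreeMetabelianLie K n ≃ₗ⁅K⁆ FreeMetabelianLie K n) (d : ℕ) : Prop :=
  ∀ i : Fin n, φ (xg K n i) ∈
    gradePiece K n 1 ⊔ ⨆ (k : ℕ) (_ : d ≤ k), gradePiece K n k

/-- The action of a polynomial `a ∈ U = K[y₁,…,yₙ]` on `m`; for `m ∈ [M,M]` this is the
canonical `U`-module action on the derived ideal, determined by `m ⬝ yᵢ = ⁅m, xᵢ⁆`. -/
def polyAct (K : Type) [Field K] (n : ℕ) (a : MvPolynomial (Fin n) K)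
    (m : FreeMetabelianLie K n) : FreeMetabelianLie K n :=
  ∑ d ∈ a.support, a.coeff d •
    ((List.ofFn fun i : Fin n =>
      (-(LieAlgebra.ad K (FreeMetabelianLie K n) (xg K n i))) ^ (d i)).prod m)

/-- The polynomial `a` has lower degree `≥ d`: every monomial of `a` has total degree `≥ d`. -/
def PolyLdegGE (K : Type) [Field K] (n : ℕ) (a : MvPolynomial (Fin n) K) (d : ℕ) : Prop :=
  ∀ v ∈ a.support, d ≤ ∑ i, v i

/-- An exponential automorphism: `exp (ad z) = id + ad z` for some `z ∈ [M,M]`. -/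
def IsExponentialAut (K : Type) [Field K] (n : ℕ)
    (φ : FreeMetabelianLie K n ≃ₗ⁅K⁆ FreeMetabelianLie K n) : Prop :=
  ∃ z ∈ LieAlgebra.derivedSeries K (FreeMetabelianLie K n) 1,
    ∀ m : FreeMetabelianLie K n, φ m = m + ⁅z, m⁆

end

namespace FreeMetabelianLie

noncomputable section Basics

variable {K : Type} [Field K] {n : ℕ}

theorem lie_mem_derivedSeries_succ {L : Type*} [LieRing L] [LieAlgebra K L] {k : ℕ} {a b : L}
    (ha : a ∈ LieAlgebra.derivedSeries K L k) (hb : b ∈ LieAlgebra.derivedSeries K L k) :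
    ⁅a, b⁆ ∈ LieAlgebra.derivedSeries K L (k + 1) := by
  rw [LieAlgebra.derivedSeries_def, LieAlgebra.derivedSeriesOfIdeal_succ]
  exact LieSubmodule.lie_mem_lie ha hb

theorem derivedSeries_two_eq_bot_of_metabelian {L : Type*} [LieRing L] [LieAlgebra K L]
    (h : ∀ a b c d : L, ⁅⁅a, b⁆, ⁅c, d⁆⁆ = 0) : LieAlgebra.derivedSeries K L 2 = ⊥ := by
  rw [LieAlgebra.derivedSeries_def, LieAlgebra.derivedSeriesOfIdeal_succ,
    LieSubmodule.lie_eq_bot_iff]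
  have key : ∀ x ∈ LieAlgebra.derivedSeriesOfIdeal K L 1 ⊤,
      x ∈ Submodule.span K {m | ∃ a b : L, ⁅a, b⁆ = m} := by
    intro x hx
    rw [LieAlgebra.derivedSeriesOfIdeal_succ, ← LieSubmodule.mem_toSubmodule,
      LieSubmodule.lieIdeal_oper_eq_linear_span] at hx
    refine Submodule.span_mono ?_ hx
    rintro m ⟨a, b, rfl⟩
    exact ⟨a, b, rfl⟩
  intro x hx y hy
  have hx' := key x hx
  have hy' := key y hy
  clear hx hy
  induction hx' using Submodule.span_induction with
  | mem x hx1 =>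
    obtain ⟨a, b, rfl⟩ := hx1
    induction hy' using Submodule.span_induction with
    | mem y hy1 =>
      obtain ⟨c, d, rfl⟩ := hy1
      exact h a b c d
    | zero => simp
    | add _ _ _ _ h1 h2 => rw [lie_add, h1, h2, add_zero]
    | smul _ _ _ h1 => rw [lie_smul, h1, smul_zero]
  | zero => simp
  | add _ _ _ _ h1 h2 => rw [add_lie, h1, h2, add_zero]
  | smul _ _ _ h1 => rw [smul_lie, h1, smul_zero]

/-- The projection from the free Lie algebra. -/
def proj (K : Type) [Field K] (n : ℕ) :
    FreeLieAlgebra K (Fin n) →ₗ⁅K⁆ FreeMetabelianLie K n :=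
  { (LieSubmodule.Quotient.mk' (LieAlgebra.derivedSeries K (FreeLieAlgebra K (Fin n)) 2) :
      FreeLieAlgebra K (Fin n) →ₗ[K] FreeMetabelianLie K n) with
    map_lie' := fun {_ _} => LieSubmodule.Quotient.mk_bracket _ _ _ }

theorem proj_surjective : Function.Surjective (proj K n) :=
  LieSubmodule.Quotient.surjective_mk' _

theorem derivedSeries_two_eq_bot :
    LieAlgebra.derivedSeries K (FreeMetabelianLie K n) 2 = ⊥ := by
  refine (LieIdeal.derivedSeries_map_eq 2 proj_surjective).symm.trans ?_
  refine (LieIdeal.map_eq_bot_iff).2 fun x hx => ?_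
  exact (LieHom.mem_ker).2 (LieSubmodule.Quotient.mk_eq_zero'.2 hx)

theorem lie_mem_derived (a b : FreeMetabelianLie K n) :
    ⁅a, b⁆ ∈ LieAlgebra.derivedSeries K (FreeMetabelianLie K n) 1 :=
  lie_mem_derivedSeries_succ (LieSubmodule.mem_top a) (LieSubmodule.mem_top b)

theorem lie_eq_zero {a b : FreeMetabelianLie K n}
    (ha : a ∈ LieAlgebra.derivedSeries K (FreeMetabelianLie K n) 1)
    (hb : b ∈ LieAlgebra.derivedSeries K (FreeMetabelianLie K n) 1) : ⁅a, b⁆ = 0 := by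
  have h := lie_mem_derivedSeries_succ ha hb
  exact (LieSubmodule.mem_bot _).1 ((derivedSeries_two_eq_bot (K := K) (n := n)).le h)

theorem lie_lie_eq_zero (a b c d : FreeMetabelianLie K n) : ⁅⁅a, b⁆, ⁅c, d⁆⁆ = 0 :=
  lie_eq_zero (lie_mem_derived a b) (lie_mem_derived c d)

/-- The universal property of the free metabelian Lie algebra. -/
theorem exists_lift {L : Type*} [LieRing L] [LieAlgebra K L]
    (h : ∀ a b c d : L, ⁅⁅a, b⁆, ⁅c, d⁆⁆ = 0) (f : Fin n → L) :
    ∃ F : FreeMetabelianLie K n →ₗ⁅K⁆ L, ∀ i, F (xg K n i) = f i := by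
  have hker : ∀ x ∈ LieAlgebra.derivedSeries K (FreeLieAlgebra K (Fin n)) 2,
      FreeLieAlgebra.lift K f x = 0 := by
    intro x hx
    have h1 := LieIdeal.derivedSeries_map_le (f := FreeLieAlgebra.lift K f) 2
      (LieIdeal.mem_map hx)
    rwa [derivedSeries_two_eq_bot_of_metabelian h, LieSubmodule.mem_bot] at h1
  refine ⟨{ Submodule.liftQ
      (LieAlgebra.derivedSeries K (FreeLieAlgebra K (Fin n)) 2).toSubmodule
      (FreeLieAlgebra.lift K f : FreeLieAlgebra K (Fin n) →ₗ[K] L) hker with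
      map_lie' := ?_ }, ?_⟩
  · intro x y
    induction x using Submodule.Quotient.induction_on
    induction y using Submodule.Quotient.induction_on
    exact LieHom.map_lie (FreeLieAlgebra.lift K f) _ _
  · intro i
    exact FreeLieAlgebra.lift_of_apply f i

theorem hom_ext {L : Type*} [LieRing L] [LieAlgebra K L] {F G : FreeMetabelianLie K n →ₗ⁅K⁆ L}
    (h : ∀ i, F (xg K n i) = G (xg K n i)) (m : FreeMetabelianLie K n) : F m = G m := by
  obtain ⟨a, rfl⟩ := proj_surjective m
  have : F.comp (proj K n) = G.comp (proj K n) := FreeLieAlgebra.hom_ext fun i => h i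
  exact LieHom.congr_fun this a

theorem equiv_ext {φ ψ : FreeMetabelianLie K n ≃ₗ⁅K⁆ FreeMetabelianLie K n}
    (h : ∀ i, φ (xg K n i) = ψ (xg K n i)) : φ = ψ :=
  LieEquiv.ext fun m => hom_ext (F := φ.toLieHom) (G := ψ.toLieHom) h m

@[elab_as_elim]
theorem xg_induction {p : FreeMetabelianLie K n → Prop} (m : FreeMetabelianLie K n)
    (gen : ∀ i, p (xg K n i)) (zero : p 0) (add : ∀ a b, p a → p b → p (a + b))
    (smul : ∀ (c : K) (a), p a → p (c • a)) (lie : ∀ a b, p a → p b → p ⁅a, b⁆) : p m := by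
  let S : LieSubalgebra K (FreeMetabelianLie K n) :=
    { carrier := {a | p a}
      add_mem' := fun {_ _} => add _ _
      zero_mem' := zero
      smul_mem' := smul
      lie_mem' := fun {_ _} => lie _ _ }
  obtain ⟨F, hF⟩ := exists_lift (K := K) (L := S)
    (fun _ _ _ _ => Subtype.ext (lie_lie_eq_zero _ _ _ _)) fun i => ⟨xg K n i, gen i⟩
  have h := hom_ext (F := S.incl.comp F) (G := LieHom.id)
    (fun i => by simp only [LieHom.comp_apply, hF]; rfl) m
  have h' : ((F m : S) : FreeMetabelianLie K n) = m := h
  rw [← h']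
  exact (F m).2

/-- The derived ideal of the free metabelian Lie algebra, as a type. -/
abbrev Derived (K : Type) [Field K] (n : ℕ) : Type :=
  ↥(LieAlgebra.derivedSeries K (FreeMetabelianLie K n) 1)

/-- The operator `m ↦ ⁅m, xᵢ⁆` on the derived ideal. -/
def lieRight (K : Type) [Field K] (n : ℕ) (i : Fin n) : Module.End K (Derived K n) where
  toFun m := ⟨⁅(m : FreeMetabelianLie K n), xg K n i⁆, lie_mem_derived _ _⟩
  map_add' _ _ := Subtype.ext (add_lie _ _ _)
  map_smul' _ _ := Subtype.ext (smul_lie _ _ _)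

theorem lieRight_comm (i j : Fin n) :
    lieRight K n i * lieRight K n j = lieRight K n j * lieRight K n i := by
  refine LinearMap.ext fun m => Subtype.ext ?_
  change ⁅⁅(m : FreeMetabelianLie K n), xg K n j⁆, xg K n i⁆ = ⁅⁅(m : _), xg K n i⁆, xg K n j⁆
  have h := lie_eq_zero m.2 (lie_mem_derived (xg K n j) (xg K n i))
  rw [leibniz_lie, ← lie_skew (xg K n j), add_neg_eq_zero] at h
  exact h

/-- The action of polynomials on the derived ideal. -/
def polyHom (K : Type) [Field K] (n : ℕ) :
    MvPolynomial (Fin n) K →ₐ[K] Module.End K (Derived K n) :=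
  letI : CommRing (Algebra.adjoin K (Set.range (lieRight K n))) :=
    { (inferInstance : Ring (Algebra.adjoin K (Set.range (lieRight K n)))) with
      mul_comm := (Algebra.isMulCommutative_adjoin K (by
        rintro _ ⟨i, rfl⟩ _ ⟨j, rfl⟩
        exact lieRight_comm i j)).is_comm.comm }
  (Algebra.adjoin K (Set.range (lieRight K n))).val.comp
    (MvPolynomial.aeval fun i => ⟨lieRight K n i, Algebra.subset_adjoin ⟨i, rfl⟩⟩)

theorem polyHom_X (i : Fin n) : polyHom K n (MvPolynomial.X i) = lieRight K n i := by
  simp [polyHom]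

instance instModuleDerived : Module (MvPolynomial (Fin n) K) (Derived K n) :=
  Module.compHom _ (polyHom K n).toRingHom

theorem X_smul (i : Fin n) (m : Derived K n) :
    (((MvPolynomial.X i : MvPolynomial (Fin n) K) • m : Derived K n) : FreeMetabelianLie K n) =
      ⁅(m : FreeMetabelianLie K n), xg K n i⁆ := by
  change ((polyHom K n (MvPolynomial.X i) m : Derived K n) : FreeMetabelianLie K n) = _
  rw [polyHom_X]
  rfl

theorem C_smul (c : K) (m : Derived K n) :
    (MvPolynomial.C c : MvPolynomial (Fin n) K) • m = c • m := by
  change polyHom K n (MvPolynomial.C c) m = _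
  rw [← MvPolynomial.algebraMap_eq, AlgHom.commutes]
  rfl

instance : IsScalarTower K (MvPolynomial (Fin n) K) (Derived K n) :=
  ⟨fun c p m => by rw [MvPolynomial.smul_eq_C_mul, mul_smul, C_smul]⟩

/-- The commutator `⁅xₐ, x_b⁆` as an element of the derived ideal. -/
def comm (K : Type) [Field K] (n : ℕ) (a b : Fin n) : Derived K n :=
  ⟨⁅xg K n a, xg K n b⁆, lie_mem_derived _ _⟩

theorem comm_skew (a b : Fin n) : comm K n b a = -comm K n a b :=
  Subtype.ext (lie_skew _ _).symm

theorem jacobi (a b c : Fin n) :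
    (MvPolynomial.X c : MvPolynomial (Fin n) K) • comm K n a b +
      (MvPolynomial.X a : MvPolynomial (Fin n) K) • comm K n b c +
      (MvPolynomial.X b : MvPolynomial (Fin n) K) • comm K n c a = 0 := by
  refine Subtype.ext ?_
  change ((MvPolynomial.X c : MvPolynomial (Fin n) K) • comm K n a b : Derived K n).1 +
    ((MvPolynomial.X a : MvPolynomial (Fin n) K) • comm K n b c : Derived K n).1 +
    ((MvPolynomial.X b : MvPolynomial (Fin n) K) • comm K n c a : Derived K n).1 = 0
  rw [X_smul, X_smul, X_smul]
  have := lie_jacobi (xg K n a) (xg K n b) (xg K n c)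
  simp only [comm]
  rw [← lie_skew ⁅xg K n a, xg K n b⁆, ← lie_skew ⁅xg K n b, xg K n c⁆,
    ← lie_skew ⁅xg K n c, xg K n a⁆, ← neg_add, ← neg_add, neg_eq_zero, ← this]
  abel

theorem comm_self (a : Fin n) : comm K n a a = 0 :=
  Subtype.ext (lie_self _)

theorem map_mem_derived (φ : FreeMetabelianLie K n →ₗ⁅K⁆ FreeMetabelianLie K n)
    (z : Derived K n) :
    φ z ∈ LieAlgebra.derivedSeries K (FreeMetabelianLie K n) 1 :=
  LieIdeal.derivedSeries_map_le (f := φ) 1 (LieIdeal.mem_map z.2)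

/-- The restriction of a Lie algebra endomorphism to the derived ideal. -/
def derivedMap (φ : FreeMetabelianLie K n →ₗ⁅K⁆ FreeMetabelianLie K n) :
    Derived K n →ₗ[K] Derived K n where
  toFun z := ⟨φ z, map_mem_derived φ z⟩
  map_add' _ _ := Subtype.ext (map_add φ _ _)
  map_smul' _ _ := Subtype.ext (map_smul φ _ _)

theorem coe_derivedMap (φ : FreeMetabelianLie K n →ₗ⁅K⁆ FreeMetabelianLie K n)
    (z : Derived K n) : (derivedMap φ z : FreeMetabelianLie K n) = φ z := rfl

theorem derivedMap_smul_of_X {φ : FreeMetabelianLie K n →ₗ⁅K⁆ FreeMetabelianLie K n}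
    {σ : MvPolynomial (Fin n) K →ₐ[K] MvPolynomial (Fin n) K}
    (h : ∀ i (z : Derived K n), derivedMap φ ((MvPolynomial.X i : MvPolynomial (Fin n) K) • z) =
      σ (MvPolynomial.X i) • derivedMap φ z) (p : MvPolynomial (Fin n) K) (z : Derived K n) :
    derivedMap φ (p • z) = σ p • derivedMap φ z := by
  induction p using MvPolynomial.induction_on generalizing z with
  | C c =>
    rw [C_smul, map_smul, ← MvPolynomial.algebraMap_eq, AlgHom.commutes,
      MvPolynomial.algebraMap_eq, C_smul]
  | add p q hp hq => rw [add_smul, map_add, hp, hq, map_add, add_smul]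
  | mul_X p i hp => rw [mul_smul, hp, h, smul_smul, ← map_mul]

theorem lie_derived_right (i : Fin n) (z : Derived K n) :
    ⁅xg K n i, (z : FreeMetabelianLie K n)⁆ =
      -((MvPolynomial.X i : MvPolynomial (Fin n) K) • z : Derived K n) := by
  rw [X_smul, lie_skew]

/-- `φ` shifts each generator `xᵢ` by `f i`. -/
def IsShift (φ : FreeMetabelianLie K n ≃ₗ⁅K⁆ FreeMetabelianLie K n) (f : Fin n → Derived K n) :
    Prop :=
  ∀ i, φ (xg K n i) = xg K n i + f i

theorem IsShift.derivedMap_smul {φ : FreeMetabelianLie K n ≃ₗ⁅K⁆ FreeMetabelianLie K n}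
    {f : Fin n → Derived K n} (h : IsShift φ f) (p : MvPolynomial (Fin n) K) (z : Derived K n) :
    derivedMap φ.toLieHom (p • z) = p • derivedMap φ.toLieHom z := by
  refine derivedMap_smul_of_X (σ := AlgHom.id K _) (fun i z => Subtype.ext ?_) p z
  have h1 : φ ⁅(z : FreeMetabelianLie K n), xg K n i⁆ =
      ⁅φ (z : FreeMetabelianLie K n), xg K n i⁆ := by
    have h2 := lie_eq_zero (map_mem_derived φ.toLieHom z) (f i).2
    rw [LieEquiv.coe_toLieHom] at h2
    rw [LieEquiv.map_lie, h i, lie_add, h2, add_zero]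
  rw [AlgHom.id_apply, X_smul, coe_derivedMap, X_smul]
  exact h1

theorem IsShift.derivedMap_comm {φ : FreeMetabelianLie K n ≃ₗ⁅K⁆ FreeMetabelianLie K n}
    {f : Fin n → Derived K n} (h : IsShift φ f) (a b : Fin n) :
    derivedMap φ.toLieHom (comm K n a b) = comm K n a b +
      (MvPolynomial.X b : MvPolynomial (Fin n) K) • f a -
      (MvPolynomial.X a : MvPolynomial (Fin n) K) • f b := by
  refine Subtype.ext ?_
  have h1 : φ ⁅xg K n a, xg K n b⁆ = ⁅xg K n a, xg K n b⁆ +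
      ⁅(f a : FreeMetabelianLie K n), xg K n b⁆ - ⁅(f b : FreeMetabelianLie K n), xg K n a⁆ := by
    rw [LieEquiv.map_lie, h a, h b, lie_add, add_lie, add_lie, lie_eq_zero (f a).2 (f b).2,
      lie_derived_right, X_smul]
    abel
  rw [← X_smul, ← X_smul] at h1
  exact h1

/-- The shift by `f` is induced by a tame automorphism. -/
def TameShift (f : Fin n → Derived K n) : Prop :=
  ∃ φ, IsTame K n φ ∧ IsShift φ f

theorem isTame_mul {φ ψ : FreeMetabelianLie K n ≃ₗ⁅K⁆ FreeMetabelianLie K n}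
    (hφ : IsTame K n φ) (hψ : IsTame K n ψ) : IsTame K n (φ * ψ) :=
  Subgroup.mul_mem _ hφ hψ

theorem isTame_inv {φ : FreeMetabelianLie K n ≃ₗ⁅K⁆ FreeMetabelianLie K n}
    (hφ : IsTame K n φ) : IsTame K n φ⁻¹ :=
  Subgroup.inv_mem _ hφ

theorem TameShift.congr {f g : Fin n → Derived K n} (hf : TameShift f) (h : ∀ i, f i = g i) :
    TameShift g :=
  (funext h : f = g) ▸ hf

theorem tameShift_zero : TameShift (0 : Fin n → Derived K n) :=
  ⟨1, Subgroup.one_mem _, fun i => by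
    change xg K n i = xg K n i + ((0 : Derived K n) : FreeMetabelianLie K n)
    rw [ZeroMemClass.coe_zero, add_zero]⟩

theorem TameShift.comp {f g : Fin n → Derived K n} (hf : TameShift f)
    {v : Fin n → MvPolynomial (Fin n) K} {a b : Fin n} (hg : TameShift g)
    (hv : ∀ i, g i = v i • comm K n a b) :
    TameShift fun i => f i + v i • (comm K n a b +
      (MvPolynomial.X b : MvPolynomial (Fin n) K) • f a -
      (MvPolynomial.X a : MvPolynomial (Fin n) K) • f b) := by
  obtain ⟨φ, hφ, hφf⟩ := hf
  obtain ⟨ψ, hψ, hψg⟩ := hg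
  refine ⟨φ * ψ, isTame_mul hφ hψ, fun i => ?_⟩
  change φ (ψ (xg K n i)) = _
  simp only [← hφf.derivedMap_comm a b, ← hφf.derivedMap_smul]
  rw [hψg i, map_add, hφf i, hv i]
  exact add_assoc _ _ _

/-- If the tame shift by `f` fixes all `f i`, the shift by `-f` is tame. -/
theorem TameShift.neg_of_fixed {f : Fin n → Derived K n} (hf : TameShift f)
    (h : ∀ φ, IsShift φ f → ∀ i, derivedMap φ.toLieHom (f i) = f i) : TameShift (-f) := by
  obtain ⟨φ, hφ, hφf⟩ := hf
  refine ⟨φ⁻¹, isTame_inv hφ, fun i => ?_⟩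
  change φ.symm (xg K n i) = _
  have h1 : φ (xg K n i + (-f i : Derived K n)) = xg K n i := by
    have h2 : φ (f i : FreeMetabelianLie K n) = f i := congrArg Subtype.val (h φ hφf i)
    rw [NegMemClass.coe_neg, map_add, map_neg, h2, hφf i, add_neg_cancel_right]
  conv_lhs => rw [← h1]
  exact φ.symm_apply_apply _

/-- The tame shifts of the form `xᵢ ↦ xᵢ + v i • z`. -/
def TameMul (v : Fin n → MvPolynomial (Fin n) K) (z : Derived K n) : Prop :=
  TameShift fun i => v i • z

/-- The coefficient of the derivative of `⁅xₐ, x_b⁆` along `w`. -/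
def pairing (a b : Fin n) (w : Fin n → MvPolynomial (Fin n) K) : MvPolynomial (Fin n) K :=
  MvPolynomial.X b * w a - MvPolynomial.X a * w b

variable {a b c d : Fin n} {v w : Fin n → MvPolynomial (Fin n) K}

theorem TameMul.add (hv : TameMul v (comm K n a b)) (hw : TameMul w (comm K n a b))
    (h : pairing a b v = 0) : TameMul (v + w) (comm K n a b) := by
  refine (TameShift.comp hv hw fun _ => rfl).congr fun i => ?_
  simp only [pairing] at h
  simp only [Pi.add_apply]
  linear_combination (norm := module) (w i * h) • comm K n a b

theorem TameMul.neg (hv : TameMul v (comm K n a b)) (h : pairing a b v = 0) :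
    TameMul (-v) (comm K n a b) := by
  refine (TameShift.neg_of_fixed hv fun φ hφ i => ?_).congr fun i => (neg_smul _ _).symm
  simp only [pairing] at h
  rw [hφ.derivedMap_smul, hφ.derivedMap_comm]
  linear_combination (norm := module) (v i * h) • comm K n a b

theorem TameMul.commutator (hv : TameMul v (comm K n c d)) (hw : TameMul w (comm K n a b))
    (hav : pairing a b v = 0) (haw : pairing a b w = 0) (hcv : pairing c d v = 0) :
    TameMul (fun i => pairing c d w * v i) (comm K n a b) := by
  have hwn := hw.neg haw
  have hvn := hv.neg hcv
  simp only [TameMul] at hv hw hvn hwn ⊢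
  obtain ⟨q, hq⟩ : ∃ q, pairing c d w = q := ⟨_, rfl⟩
  simp only [hq]
  simp only [pairing] at hav haw hcv hq
  generalize hr : comm K n a b = r at *
  generalize hs : comm K n c d = s at *
  have h1 : TameShift fun i => w i • r + v i • s + (v i * q) • r := by
    refine (TameShift.comp (a := c) (b := d) hw hv fun _ => by rw [hs]).congr fun i => ?_
    rw [hs, ← hq]
    module
  have h2 : TameShift fun i => v i • s + (v i * q) • r := by
    refine (TameShift.comp (a := a) (b := b) h1 hwn fun _ => by rw [hr]).congr fun i => ?_
    simp only [hr, Pi.neg_apply]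
    linear_combination (norm := module) (-w i * haw) • r - (w i * hav) • s -
      (w i * q * hav) • r
  refine (TameShift.comp (a := c) (b := d) h2 hvn fun _ => by rw [hs]).congr fun i => ?_
  simp only [hs, Pi.neg_apply]
  linear_combination (norm := module) (-v i * hcv) • s - (v i * q * hcv) • r

section Generators

theorem exists_elementary (i : Fin n) {α : K} (hα : α ≠ 0) {f : FreeMetabelianLie K n}
    (hf : f ∈ LieSubalgebra.lieSpan K (FreeMetabelianLie K n) (xg K n '' {j | j ≠ i})) :
    ∃ φ, IsElementaryAut K n φ ∧ φ (xg K n i) = α • xg K n i + f ∧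
      ∀ j ≠ i, φ (xg K n j) = xg K n j := by
  have fix : ∀ F : FreeMetabelianLie K n →ₗ⁅K⁆ FreeMetabelianLie K n,
      (∀ j ≠ i, F (xg K n j) = xg K n j) → F f = f := by
    intro F hF
    induction hf using LieSubalgebra.lieSpan_induction with
    | mem x hx =>
      obtain ⟨j, hj, rfl⟩ := hx
      exact hF j hj
    | zero => exact map_zero F
    | add _ _ _ _ h1 h2 => rw [map_add, h1, h2]
    | smul _ _ _ h1 => rw [map_smul, h1]
    | lie _ _ _ _ h1 h2 => rw [LieHom.map_lie, h1, h2]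
  obtain ⟨F, hF⟩ := exists_lift (K := K) (lie_lie_eq_zero (n := n))
    (Function.update (xg K n) i (α • xg K n i + f))
  obtain ⟨G, hG⟩ := exists_lift (K := K) (lie_lie_eq_zero (n := n))
    (Function.update (xg K n) i (α⁻¹ • (xg K n i - f)))
  have hFi : F (xg K n i) = α • xg K n i + f := by rw [hF, Function.update_self]
  have hGi : G (xg K n i) = α⁻¹ • (xg K n i - f) := by rw [hG, Function.update_self]
  have hFj : ∀ j ≠ i, F (xg K n j) = xg K n j := fun j hj => by
    rw [hF, Function.update_of_ne hj]
  have hGj : ∀ j ≠ i, G (xg K n j) = xg K n j := fun j hj => by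
    rw [hG, Function.update_of_ne hj]
  have hFG : ∀ m, F (G m) = m := fun m => by
    refine hom_ext (F := F.comp G) (G := LieHom.id) (fun j => ?_) m
    change F (G (xg K n j)) = xg K n j
    by_cases hj : j = i
    · rw [hj, hGi, map_smul, map_sub, hFi, fix F hFj, add_sub_cancel_right, smul_smul,
        inv_mul_cancel₀ hα, one_smul]
    · rw [hGj j hj, hFj j hj]
  have hGF : ∀ m, G (F m) = m := fun m => by
    refine hom_ext (F := G.comp F) (G := LieHom.id) (fun j => ?_) m
    change G (F (xg K n j)) = xg K n j
    by_cases hj : j = i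
    · rw [hj, hFi, map_add, map_smul, hGi, fix G hGj, smul_smul, mul_inv_cancel₀ hα, one_smul,
        sub_add_cancel]
    · rw [hFj j hj, hGj j hj]
  let φ : FreeMetabelianLie K n ≃ₗ⁅K⁆ FreeMetabelianLie K n :=
    { F with invFun := G, left_inv := hGF, right_inv := hFG }
  exact ⟨φ, ⟨i, α, f, hα, hf, hFi, hFj⟩, hFi, hFj⟩

theorem xg_mem_lieSpan {i j : Fin n} (h : j ≠ i) :
    xg K n j ∈ LieSubalgebra.lieSpan K (FreeMetabelianLie K n) (xg K n '' {j | j ≠ i}) :=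
  LieSubalgebra.subset_lieSpan ⟨j, h, rfl⟩

theorem monomial_smul_mem_lieSpan {i : Fin n} (d : Fin n →₀ ℕ) (hd : d i = 0) (c : K)
    {m : Derived K n}
    (hm : (m : FreeMetabelianLie K n) ∈
      LieSubalgebra.lieSpan K (FreeMetabelianLie K n) (xg K n '' {j | j ≠ i})) :
    ((MvPolynomial.monomial d c • m : Derived K n) : FreeMetabelianLie K n) ∈
      LieSubalgebra.lieSpan K (FreeMetabelianLie K n) (xg K n '' {j | j ≠ i}) := by
  have key : ∀ m : Derived K n, (m : FreeMetabelianLie K n) ∈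
      LieSubalgebra.lieSpan K (FreeMetabelianLie K n) (xg K n '' {j | j ≠ i}) →
      ((MvPolynomial.monomial d (1 : K) • m : Derived K n) : FreeMetabelianLie K n) ∈
        LieSubalgebra.lieSpan K (FreeMetabelianLie K n) (xg K n '' {j | j ≠ i}) := by
    clear hm m
    induction d using Finsupp.induction_linear with
    | zero =>
      intro m hm
      rwa [← MvPolynomial.C_apply, map_one, one_smul]
    | add f g hf hg =>
      intro m hm
      rw [Finsupp.add_apply, Nat.add_eq_zero_iff] at hd
      rw [← one_mul (1 : K), ← MvPolynomial.monomial_mul, mul_smul]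
      exact hf hd.1 _ (hg hd.2 _ hm)
    | single j k =>
      rw [← MvPolynomial.X_pow_eq_monomial]
      induction k with
      | zero =>
        intro m hm
        rwa [pow_zero, one_smul]
      | succ k ih =>
        have hj : j ≠ i := fun h => by simp [h] at hd
        intro m hm
        rw [pow_succ, mul_smul]
        refine ih (by simp [hj]) _ ?_
        rw [X_smul]
        exact LieSubalgebra.lie_mem _ hm (xg_mem_lieSpan hj)
  rw [← mul_one c, ← MvPolynomial.C_mul_monomial, mul_smul, C_smul]
  exact LieSubalgebra.smul_mem _ _ (key m hm)

theorem tameMul_single_monomial {i a b : Fin n} (ha : a ≠ i) (hb : b ≠ i) (d : Fin n →₀ ℕ)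
    (hd : d i = 0) (c : K) :
    TameMul (Pi.single i (MvPolynomial.monomial d c)) (comm K n a b) := by
  have hm : (comm K n a b : FreeMetabelianLie K n) ∈
      LieSubalgebra.lieSpan K (FreeMetabelianLie K n) (xg K n '' {j | j ≠ i}) :=
    LieSubalgebra.lie_mem _ (xg_mem_lieSpan ha) (xg_mem_lieSpan hb)
  obtain ⟨φ, h, h1, h2⟩ := exists_elementary i one_ne_zero (monomial_smul_mem_lieSpan d hd c hm)
  refine ⟨φ, Subgroup.subset_closure h, fun j => ?_⟩
  by_cases hj : j = i
  · subst hj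
    beta_reduce
    rw [h1, one_smul, Pi.single_eq_same]
  · beta_reduce
    rw [h2 j hj, Pi.single_eq_of_ne hj, zero_smul, ZeroMemClass.coe_zero, add_zero]

end Generators

section Shear

/-- The linear substitution `x_p ↦ x_p + c x_q`, all other generators being fixed. -/
def IsShear (φ : FreeMetabelianLie K n ≃ₗ⁅K⁆ FreeMetabelianLie K n) (p q : Fin n) (c : K) : Prop :=
  ∀ i, φ (xg K n i) = xg K n i + (Pi.single p c : Fin n → K) i • xg K n q

theorem exists_isShear {p q : Fin n} (h : q ≠ p) (c : K) :
    ∃ φ, IsTame K n φ ∧ IsShear φ p q c := by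
  obtain ⟨φ, hφ, h1, h2⟩ := exists_elementary p one_ne_zero
    (LieSubalgebra.smul_mem _ c (xg_mem_lieSpan (K := K) h))
  refine ⟨φ, Subgroup.subset_closure hφ, fun j => ?_⟩
  by_cases hj : j = p
  · rw [hj, h1, one_smul, Pi.single_eq_same]
  · rw [h2 j hj, Pi.single_eq_of_ne hj, zero_smul, add_zero]

/-- The polynomial substitution accompanying a shear. -/
def shearAlg (p q : Fin n) (c : K) : MvPolynomial (Fin n) K →ₐ[K] MvPolynomial (Fin n) K :=
  MvPolynomial.aeval fun i =>
    MvPolynomial.X i + (Pi.single p c : Fin n → K) i • MvPolynomial.X q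

theorem shearAlg_X (p q : Fin n) (c : K) (i : Fin n) :
    shearAlg p q c (MvPolynomial.X i) =
      MvPolynomial.X i + (Pi.single p c : Fin n → K) i • MvPolynomial.X q :=
  MvPolynomial.aeval_X _ _

theorem shearAlg_shearAlg_neg {p q : Fin n} (h : q ≠ p) (c : K) (f : MvPolynomial (Fin n) K) :
    shearAlg p q c (shearAlg p q (-c) f) = f := by
  have : (shearAlg p q c).comp (shearAlg p q (-c)) = AlgHom.id K _ := by
    refine MvPolynomial.algHom_ext fun i => ?_
    rw [AlgHom.comp_apply, shearAlg_X, map_add, map_smul, shearAlg_X, shearAlg_X,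
      Pi.single_eq_of_ne h, Pi.single_neg, Pi.neg_apply, AlgHom.id_apply]
    module
  exact DFunLike.congr_fun this f

variable {φ : FreeMetabelianLie K n ≃ₗ⁅K⁆ FreeMetabelianLie K n} {p q : Fin n} {c : K}

theorem IsShear.derivedMap_smul (h : IsShear φ p q c) (f : MvPolynomial (Fin n) K)
    (z : Derived K n) :
    derivedMap φ.toLieHom (f • z) = shearAlg p q c f • derivedMap φ.toLieHom z := by
  refine derivedMap_smul_of_X (fun i z => Subtype.ext ?_) f z
  have h1 : φ ⁅(z : FreeMetabelianLie K n), xg K n i⁆ =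
      ⁅φ (z : FreeMetabelianLie K n), xg K n i⁆ +
        (Pi.single p c : Fin n → K) i • ⁅φ (z : FreeMetabelianLie K n), xg K n q⁆ := by
    rw [LieEquiv.map_lie, h i, lie_add, lie_smul]
  rw [shearAlg_X, add_smul, smul_assoc, coe_derivedMap, X_smul]
  refine h1.trans ?_
  change _ = ((MvPolynomial.X i : MvPolynomial (Fin n) K) • derivedMap φ.toLieHom z : Derived K n).1
    + (Pi.single p c : Fin n → K) i •
      ((MvPolynomial.X q : MvPolynomial (Fin n) K) • derivedMap φ.toLieHom z : Derived K n).1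
  rw [X_smul, X_smul]
  rfl

theorem IsShear.derivedMap_comm (h : IsShear φ p q c) (a b : Fin n) :
    derivedMap φ.toLieHom (comm K n a b) = comm K n a b +
      (Pi.single p c : Fin n → K) a • comm K n q b +
      (Pi.single p c : Fin n → K) b • comm K n a q := by
  refine Subtype.ext ?_
  have h1 : φ ⁅xg K n a, xg K n b⁆ = ⁅xg K n a, xg K n b⁆ +
      (Pi.single p c : Fin n → K) a • ⁅xg K n q, xg K n b⁆ +
      (Pi.single p c : Fin n → K) b • ⁅xg K n a, xg K n q⁆ := by
    rw [LieEquiv.map_lie, h a, h b]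
    simp only [lie_add, add_lie, lie_smul, smul_lie, lie_self, smul_zero, add_zero]
  exact h1

theorem TameShift.conj {f : Fin n → Derived K n} (hf : TameShift f) (hφ : IsTame K n φ)
    (h : IsShear φ p q c) (hpq : q ≠ p) :
    TameShift fun i => derivedMap φ.toLieHom (f i) -
      (Pi.single p c : Fin n → K) i • derivedMap φ.toLieHom (f q) := by
  obtain ⟨ψ, hψ, hψf⟩ := hf
  refine ⟨φ * ψ * φ⁻¹, isTame_mul (isTame_mul hφ hψ) (isTame_inv hφ), fun i => ?_⟩
  have h1 : φ.symm (xg K n i) = xg K n i - (Pi.single p c : Fin n → K) i • xg K n q := by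
    rw [← φ.symm_apply_apply (xg K n i - _), map_sub, map_smul, h i, h q, Pi.single_eq_of_ne hpq,
      zero_smul, add_zero, add_sub_cancel_right]
  change φ (ψ (φ.symm (xg K n i))) = _
  rw [h1, map_sub, map_smul, hψf i, hψf q, map_sub, map_smul, map_add, map_add, h i, h q,
    Pi.single_eq_of_ne hpq, zero_smul, add_zero]
  change _ = _ + (φ (f i : FreeMetabelianLie K n) -
    (Pi.single p c : Fin n → K) i • φ (f q : FreeMetabelianLie K n))
  module

theorem TameMul.shear {v : Fin n → MvPolynomial (Fin n) K} {a b : Fin n}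
    (hv : TameMul v (comm K n a b)) (hpq : q ≠ p) (c : K) :
    TameShift fun i => (shearAlg p q c (v i) -
      (Pi.single p c : Fin n → K) i • shearAlg p q c (v q)) •
        (comm K n a b + (Pi.single p c : Fin n → K) a • comm K n q b +
          (Pi.single p c : Fin n → K) b • comm K n a q) := by
  obtain ⟨φ, hφ, h⟩ := exists_isShear hpq c
  refine (TameShift.conj hv hφ h hpq).congr fun i => ?_
  rw [h.derivedMap_smul, h.derivedMap_smul, h.derivedMap_comm, sub_smul, smul_assoc]

end Shear

section CheinGroup

/-- The `U`-submodule of the derived ideal generated by the commutators not involving `xᵢ`. -/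
def commSpan (K : Type) [Field K] {n : ℕ} (i : Fin n) :
    Submodule (MvPolynomial (Fin n) K) (Derived K n) :=
  Submodule.span _ {z | ∃ a b, a ≠ i ∧ b ≠ i ∧ z = comm K n a b}

theorem comm_mem_commSpan {i a b : Fin n} (ha : a ≠ i) (hb : b ≠ i) :
    comm K n a b ∈ commSpan K i :=
  Submodule.subset_span ⟨a, b, ha, hb, rfl⟩

theorem IsShift.derivedMap_of_mem_commSpan
    {φ : FreeMetabelianLie K n ≃ₗ⁅K⁆ FreeMetabelianLie K n} {i : Fin n} {m : Derived K n}
    (h : IsShift φ (Pi.single i m)) {z : Derived K n} (hz : z ∈ commSpan K i) :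
    derivedMap φ.toLieHom z = z := by
  induction hz using Submodule.span_induction with
  | mem z hz =>
    obtain ⟨a, b, ha, hb, rfl⟩ := hz
    rw [h.derivedMap_comm, Pi.single_eq_of_ne ha, Pi.single_eq_of_ne hb, smul_zero, smul_zero,
      add_zero, sub_zero]
  | zero => exact map_zero _
  | add _ _ _ _ h1 h2 => rw [map_add, h1, h2]
  | smul p z _ h1 => rw [h.derivedMap_smul, h1]

/-- The elements `m` of `commSpan K i` for which `xᵢ ↦ xᵢ + m` is tame. -/
def cheinGroup (K : Type) [Field K] {n : ℕ} (i : Fin n) : AddSubgroup (Derived K n) where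
  carrier := {m | m ∈ commSpan K i ∧ TameShift (Pi.single i m)}
  zero_mem' := ⟨Submodule.zero_mem _, tameShift_zero.congr fun _ => by rw [Pi.single_zero]⟩
  add_mem' := by
    rintro x y ⟨hx, φ, hφ, hφx⟩ ⟨hy, ψ, hψ, hψy⟩
    refine ⟨Submodule.add_mem _ hx hy, φ * ψ, isTame_mul hφ hψ, fun j => ?_⟩
    change φ (ψ (xg K n j)) = _
    rw [hψy j, map_add, hφx j, Pi.single_add, Pi.add_apply]
    have h1 : derivedMap φ.toLieHom ((Pi.single i y : Fin n → Derived K n) j) =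
        (Pi.single i y : Fin n → Derived K n) j := by
      by_cases hj : j = i
      · subst hj
        rw [Pi.single_eq_same, hφx.derivedMap_of_mem_commSpan hy]
      · rw [Pi.single_eq_of_ne hj, map_zero]
    rw [show φ ((Pi.single i y : Fin n → Derived K n) j : FreeMetabelianLie K n) = _ from
      congrArg Subtype.val h1]
    exact add_assoc _ _ _
  neg_mem' := by
    rintro x ⟨hx, hx'⟩
    refine ⟨Submodule.neg_mem _ hx, (hx'.neg_of_fixed fun φ hφ j => ?_).congr fun j => ?_⟩
    · by_cases hj : j = i
      · subst hj
        rw [Pi.single_eq_same, hφ.derivedMap_of_mem_commSpan hx]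
      · rw [Pi.single_eq_of_ne hj, map_zero]
    · rw [Pi.single_neg]

theorem mem_cheinGroup {i : Fin n} {m : Derived K n} :
    m ∈ cheinGroup K i ↔ m ∈ commSpan K i ∧ TameShift (Pi.single i m) := Iff.rfl

theorem smul_comm_mem_cheinGroup {i a b : Fin n} (ha : a ≠ i) (hb : b ≠ i)
    {p : MvPolynomial (Fin n) K} :
    p • comm K n a b ∈ cheinGroup K i ↔ TameMul (Pi.single i p) (comm K n a b) := by
  rw [mem_cheinGroup]
  have h : (Pi.single i (p • comm K n a b) : Fin n → Derived K n) =
      fun j => (Pi.single i p : Fin n → MvPolynomial (Fin n) K) j • comm K n a b := by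
    ext1 j
    by_cases hj : j = i
    · subst hj
      rw [Pi.single_eq_same, Pi.single_eq_same]
    · rw [Pi.single_eq_of_ne hj, Pi.single_eq_of_ne hj, zero_smul]
  rw [h]
  exact ⟨fun h => h.2, fun h => ⟨Submodule.smul_mem _ _ (comm_mem_commSpan ha hb), h⟩⟩

theorem monomial_smul_comm_mem_cheinGroup {i a b : Fin n} (ha : a ≠ i) (hb : b ≠ i)
    {d : Fin n →₀ ℕ} (hd : d i = 0) (c : K) :
    MvPolynomial.monomial d c • comm K n a b ∈ cheinGroup K i :=
  (smul_comm_mem_cheinGroup ha hb).2 (tameMul_single_monomial ha hb d hd c)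

theorem pairing_single_of_ne {i a b : Fin n} (ha : a ≠ i) (hb : b ≠ i)
    (p : MvPolynomial (Fin n) K) : pairing a b (Pi.single i p) = 0 := by
  rw [pairing, Pi.single_eq_of_ne ha, Pi.single_eq_of_ne hb, mul_zero, mul_zero, sub_zero]

theorem smul_comm_mem_cheinGroup_of_shear {i a b p q : Fin n} {c : K} (ha : a ≠ i) (hb : b ≠ i)
    (hp : p ≠ i) (hq : q ≠ i) (hpq : q ≠ p) {f : MvPolynomial (Fin n) K}
    (h : f • comm K n a b ∈ cheinGroup K i) :
    shearAlg p q c f • (comm K n a b + (Pi.single p c : Fin n → K) a • comm K n q b +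
          (Pi.single p c : Fin n → K) b • comm K n a q) ∈ cheinGroup K i := by
  have h1 := TameMul.shear ((smul_comm_mem_cheinGroup ha hb).1 h) hpq c
  refine ⟨?_, h1.congr fun j => ?_⟩
  · refine Submodule.smul_mem _ _ (add_mem (add_mem (comm_mem_commSpan ha hb) ?_) ?_)
    · rw [← C_smul]
      exact Submodule.smul_mem _ _ (comm_mem_commSpan hq hb)
    · rw [← C_smul]
      exact Submodule.smul_mem _ _ (comm_mem_commSpan ha hq)
  · rw [Pi.single_eq_of_ne hq, map_zero, smul_zero, sub_zero]
    by_cases hj : j = i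
    · subst hj
      rw [Pi.single_eq_same, Pi.single_eq_same]
    · rw [Pi.single_eq_of_ne hj, Pi.single_eq_of_ne hj, map_zero, zero_smul]

theorem X_mul_smul_comm_mem_of_aux {i a b j k : Fin n} (ha : a ≠ i) (hb : b ≠ i) (hj : j ≠ i)
    (hki : k ≠ i) (hka : k ≠ a) (hkb : k ≠ b) (hkj : k ≠ j) (h : MvPolynomial (Fin n) K) :
    (MvPolynomial.X j * h) • comm K n a b ∈ cheinGroup K i := by
  induction h using MvPolynomial.induction_on' with
  | add p q hp hq =>
    rw [mul_add, add_smul]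
    exact add_mem hp hq
  | monomial d c =>
    have h1 : TameMul (Pi.single i (MvPolynomial.monomial (d.erase i) c)) (comm K n k j) :=
      tameMul_single_monomial hki hj _ (Finsupp.erase_same) c
    have h2 : TameMul (Pi.single k (MvPolynomial.monomial (Finsupp.single i (d i)) 1))
        (comm K n a b) :=
      tameMul_single_monomial hka.symm hkb.symm _ (Finsupp.single_eq_of_ne hki) 1
    rw [smul_comm_mem_cheinGroup ha hb]
    refine (h1.commutator h2 (pairing_single_of_ne ha hb _)
      (pairing_single_of_ne hka.symm hkb.symm _) (pairing_single_of_ne hki hj _)).congr fun l => ?_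
    rw [pairing, Pi.single_eq_same, Pi.single_eq_of_ne hkj.symm, mul_zero, sub_zero]
    congr 1
    beta_reduce
    by_cases hl : l = i
    · subst hl
      rw [Pi.single_eq_same, Pi.single_eq_same, mul_assoc, MvPolynomial.monomial_mul, one_mul,
        add_comm, Finsupp.erase_add_single]
    · rw [Pi.single_eq_of_ne hl, Pi.single_eq_of_ne hl, mul_zero]

/-- The trick with the Jacobi identity producing a factor of three. -/
theorem three_smul_X_mul_smul_comm_mem {G : AddSubgroup (Derived K n)} {a b j : Fin n}
    {h : MvPolynomial (Fin n) K}
    (h1 : (MvPolynomial.X j * h) • comm K n a b + (MvPolynomial.X a * h) • comm K n j b ∈ G)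
    (h2 : (MvPolynomial.X j * h) • comm K n a b + (MvPolynomial.X b * h) • comm K n a j ∈ G) :
    (3 * (MvPolynomial.X j * h)) • comm K n a b ∈ G := by
  have h3 := add_mem h1 h2
  have hj := jacobi (K := K) a b j
  rw [comm_skew j b, comm_skew a j] at hj
  convert h3 using 1
  linear_combination (norm := module) h • hj

theorem X_mul_smul_comm_mem_of_three {i a b j : Fin n} (h3 : (3 : K) ≠ 0) (ha : a ≠ i)
    (hb : b ≠ i) (hab : a ≠ b) (hj : j ≠ i) (hja : j ≠ a) (hjb : j ≠ b)
    (h : MvPolynomial (Fin n) K) :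
    (MvPolynomial.X j * h) • comm K n a b ∈ cheinGroup K i := by
  have key : ∀ h : MvPolynomial (Fin n) K,
      (3 * (MvPolynomial.X j * h)) • comm K n a b ∈ cheinGroup K i := by
    intro h
    refine three_smul_X_mul_smul_comm_mem ?_ ?_
    · obtain ⟨g, rfl⟩ : ∃ g, shearAlg a j 1 g = h := ⟨_, shearAlg_shearAlg_neg hja 1 h⟩
      have e1 := smul_comm_mem_cheinGroup_of_shear (c := 1) ha hb ha hj hja
        (X_mul_smul_comm_mem_of_aux ha hb ha hj hja hjb hja g)
      have e2 := X_mul_smul_comm_mem_of_aux ha hb ha hj hja hjb hja (shearAlg a j 1 g)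
      have e3 := X_mul_smul_comm_mem_of_aux hj hb hj ha hja.symm hab hja.symm (shearAlg a j 1 g)
      convert sub_mem (sub_mem e1 e2) e3 using 1
      rw [map_mul, shearAlg_X, Pi.single_eq_same, Pi.single_eq_of_ne hab.symm]
      simp only [one_smul]
      module
    · obtain ⟨g, rfl⟩ : ∃ g, shearAlg b j 1 g = h := ⟨_, shearAlg_shearAlg_neg hjb 1 h⟩
      have e1 := smul_comm_mem_cheinGroup_of_shear (c := 1) ha hb hb hj hjb
        (X_mul_smul_comm_mem_of_aux ha hb hb hj hja hjb hjb g)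
      have e2 := X_mul_smul_comm_mem_of_aux ha hb hb hj hja hjb hjb (shearAlg b j 1 g)
      have e3 := X_mul_smul_comm_mem_of_aux ha hj hj hb hab.symm hjb.symm hjb.symm
        (shearAlg b j 1 g)
      convert sub_mem (sub_mem e1 e2) e3 using 1
      rw [map_mul, shearAlg_X, Pi.single_eq_same, Pi.single_eq_of_ne hab]
      simp only [one_smul]
      module
  convert key (MvPolynomial.C (3 : K)⁻¹ * h) using 2
  rw [mul_left_comm, ← mul_assoc 3,
    show (3 : MvPolynomial (Fin n) K) = MvPolynomial.C 3 from (map_ofNat _ 3).symm,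
    ← MvPolynomial.C_mul, mul_inv_cancel₀ h3, MvPolynomial.C_1, one_mul]

theorem exists_ne_of_card (s : Finset (Fin n)) (h : s.card < n) : ∃ k, k ∉ s := by
  by_contra! hs
  have := Finset.card_le_card (fun k _ => hs k : Finset.univ ⊆ s)
  rw [Finset.card_univ, Fintype.card_fin] at this
  omega

theorem X_mul_smul_comm_mem (hK : (4 ≤ n ∧ (3 : K) ≠ 0) ∨ 5 ≤ n) {i a b j : Fin n}
    (ha : a ≠ i) (hb : b ≠ i) (hj : j ≠ i) (h : MvPolynomial (Fin n) K) :
    (MvPolynomial.X j * h) • comm K n a b ∈ cheinGroup K i := by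
  by_cases hn : ({i, a, b, j} : Finset (Fin n)).card < n
  · obtain ⟨k, hk⟩ := exists_ne_of_card _ hn
    simp only [Finset.mem_insert, Finset.mem_singleton, not_or] at hk
    exact X_mul_smul_comm_mem_of_aux ha hb hj hk.1 hk.2.1 hk.2.2.1 hk.2.2.2 h
  · have h4 : ({i, a, b, j} : Finset (Fin n)).card ≤ 4 := Finset.card_le_four
    have hn4 : 4 ≤ ({i, a, b, j} : Finset (Fin n)).card := by omega
    have h3 : (3 : K) ≠ 0 := by
      rcases hK with hK | hK
      · exact hK.2
      · omega
    have hins : ∀ x y z : Fin n, ({x, y, z} : Finset (Fin n)).card ≤ 3 :=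
      fun x y z => Finset.card_le_three
    refine X_mul_smul_comm_mem_of_three h3 ha hb ?_ hj ?_ ?_ h
    · rintro rfl
      have := hins i a j
      simp at hn4
      omega
    · rintro rfl
      have := hins i j b
      rw [show ({i, j, b, j} : Finset (Fin n)) = {i, j, b} by ext; simp; tauto] at hn4
      omega
    · rintro rfl
      have := hins i a j
      simp at hn4
      omega

end CheinGroup

section Groups

theorem pairing_add (a b : Fin n) (v w : Fin n → MvPolynomial (Fin n) K) :
    pairing a b (v + w) = pairing a b v + pairing a b w := by
  simp only [pairing, Pi.add_apply]
  ring

theorem pairing_neg (a b : Fin n) (v : Fin n → MvPolynomial (Fin n) K) :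
    pairing a b (-v) = -pairing a b v := by
  simp only [pairing, Pi.neg_apply]
  ring

/-- The `v` annihilating `⁅xₐ, x_b⁆` for which `xᵢ ↦ xᵢ + v i • ⁅xₐ, x_b⁆` is tame. -/
def mulGroup (K : Type) [Field K] {n : ℕ} (a b : Fin n) :
    AddSubgroup (Fin n → MvPolynomial (Fin n) K) where
  carrier := {v | pairing a b v = 0 ∧ TameMul v (comm K n a b)}
  zero_mem' := ⟨by simp [pairing], tameShift_zero.congr fun _ => (zero_smul _ _).symm⟩
  add_mem' := by
    rintro v w ⟨hv, hv'⟩ ⟨hw, hw'⟩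
    exact ⟨by rw [pairing_add, hv, hw, add_zero], hv'.add hw' hv⟩
  neg_mem' := by
    rintro v ⟨hv, hv'⟩
    exact ⟨by rw [pairing_neg, hv, neg_zero], hv'.neg hv⟩

theorem mem_mulGroup {a b : Fin n} {v : Fin n → MvPolynomial (Fin n) K} :
    v ∈ mulGroup K a b ↔ pairing a b v = 0 ∧ TameMul v (comm K n a b) := Iff.rfl

theorem single_mem_mulGroup {i a b : Fin n} (ha : a ≠ i) (hb : b ≠ i)
    {p : MvPolynomial (Fin n) K} :
    Pi.single i p ∈ mulGroup K a b ↔ p • comm K n a b ∈ cheinGroup K i := by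
  rw [smul_comm_mem_cheinGroup ha hb, mem_mulGroup]
  exact and_iff_right (pairing_single_of_ne ha hb p)

theorem mul_mem_mulGroup {a b l m : Fin n} {v : Fin n → MvPolynomial (Fin n) K}
    (hv : v ∈ mulGroup K l m) (hab : pairing a b v = 0) (hla : l ≠ a) (hlb : l ≠ b)
    (hlm : l ≠ m) : (fun i => MvPolynomial.X m * v i) ∈ mulGroup K a b := by
  have h := TameMul.commutator hv.2
    (tameMul_single_monomial (i := l) hla.symm hlb.symm 0 rfl (1 : K)) hab
    (pairing_single_of_ne hla.symm hlb.symm _) hv.1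
  refine ⟨?_, h.congr fun i => ?_⟩
  · simp only [pairing] at hab ⊢
    linear_combination MvPolynomial.X m * hab
  · rw [pairing, Pi.single_eq_same, Pi.single_eq_of_ne hlm.symm, mul_zero, sub_zero,
      ← MvPolynomial.C_apply, MvPolynomial.C_1, mul_one]

theorem shear_mem_mulGroup {a b p q : Fin n} {c : K} {v w : Fin n → MvPolynomial (Fin n) K}
    (hv : v ∈ mulGroup K a b) (hpq : q ≠ p) (ha : a ≠ p) (hb : b ≠ p)
    (hw : ∀ i, w i = shearAlg p q c (v i) -
      (Pi.single p c : Fin n → K) i • shearAlg p q c (v q)) : w ∈ mulGroup K a b := by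
  refine ⟨?_, (TameMul.shear hv.2 hpq c).congr fun i => ?_⟩
  · have h := congrArg (shearAlg p q c) hv.1
    rw [pairing, map_sub, map_mul, map_mul, shearAlg_X, shearAlg_X, Pi.single_eq_of_ne ha,
      Pi.single_eq_of_ne hb, zero_smul, add_zero, add_zero, map_zero] at h
    rw [pairing, hw, hw, Pi.single_eq_of_ne ha, Pi.single_eq_of_ne hb, zero_smul, sub_zero,
      sub_zero, h]
  · rw [Pi.single_eq_of_ne ha, Pi.single_eq_of_ne hb, zero_smul, zero_smul, add_zero, add_zero,
      hw]

/-- The vector with entries `yₐ p` and `y_b p` at `a` and `b`, and zero elsewhere. -/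
def pairVec (a b : Fin n) (p : MvPolynomial (Fin n) K) : Fin n → MvPolynomial (Fin n) K :=
  Pi.single a (MvPolynomial.X a * p) + Pi.single b (MvPolynomial.X b * p)

theorem pairing_pairVec {a b : Fin n} (hab : a ≠ b) (p : MvPolynomial (Fin n) K) :
    pairing a b (pairVec a b p) = 0 := by
  simp only [pairing, pairVec, Pi.add_apply, Pi.single_eq_same, Pi.single_eq_of_ne hab,
    Pi.single_eq_of_ne hab.symm]
  ring

theorem mul_pairVec (a b : Fin n) (q p : MvPolynomial (Fin n) K) :
    (fun i => q * pairVec a b p i) = pairVec a b (q * p) := by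
  funext i
  simp only [pairVec, Pi.add_apply, Pi.single_apply]
  split_ifs <;> ring

theorem pairVec_mul_mem {a b l m : Fin n} {p : MvPolynomial (Fin n) K} (hab : a ≠ b)
    (h : pairVec a b p ∈ mulGroup K l m) (hla : l ≠ a) (hlb : l ≠ b) (hlm : l ≠ m) :
    pairVec a b (MvPolynomial.X m * p) ∈ mulGroup K a b := by
  rw [← mul_pairVec]
  exact mul_mem_mulGroup h (pairing_pairVec hab p) hla hlb hlm

theorem IsShift.apply_of_inner {φ : FreeMetabelianLie K n ≃ₗ⁅K⁆ FreeMetabelianLie K n}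
    {m : Derived K n} (h : IsShift φ fun l => (MvPolynomial.X l : MvPolynomial (Fin n) K) • m)
    (z : FreeMetabelianLie K n) : φ z = z + ⁅(m : FreeMetabelianLie K n), z⁆ := by
  induction z using xg_induction with
  | gen i => rw [h i, X_smul]
  | zero => rw [map_zero, lie_zero, add_zero]
  | add a b ha hb =>
    rw [map_add, ha, hb, lie_add]
    abel
  | smul c a ha => rw [map_smul, ha, lie_smul, smul_add]
  | lie a b ha hb =>
    rw [LieEquiv.map_lie, ha, hb, lie_add, add_lie, add_lie, lie_lie_eq_zero,
      leibniz_lie (m : FreeMetabelianLie K n) a b]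
    abel

theorem IsShift.derivedMap_of_inner {φ : FreeMetabelianLie K n ≃ₗ⁅K⁆ FreeMetabelianLie K n}
    {m : Derived K n} (h : IsShift φ fun l => (MvPolynomial.X l : MvPolynomial (Fin n) K) • m)
    (z : Derived K n) : derivedMap φ.toLieHom z = z := by
  refine Subtype.ext ((h.apply_of_inner z).trans ?_)
  rw [lie_eq_zero m.2 z.2, add_zero]

/-- The elements `m` of the derived ideal for which `exp (ad m)` is tame. -/
def innGroup (K : Type) [Field K] (n : ℕ) : AddSubgroup (Derived K n) where
  carrier := {m | TameShift fun l => (MvPolynomial.X l : MvPolynomial (Fin n) K) • m}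
  zero_mem' := tameShift_zero.congr fun _ => (smul_zero _).symm
  add_mem' := by
    rintro x y ⟨φ, hφ, hφx⟩ ⟨ψ, hψ, hψy⟩
    refine ⟨φ * ψ, isTame_mul hφ hψ, fun j => ?_⟩
    change φ (ψ (xg K n j)) = _
    rw [hψy j, map_add, hφx j, show φ (((MvPolynomial.X j : MvPolynomial (Fin n) K) • y :
      Derived K n) : FreeMetabelianLie K n) = _ from
      congrArg Subtype.val (hφx.derivedMap_of_inner _)]
    beta_reduce
    rw [smul_add]
    exact add_assoc _ _ _
  neg_mem' := by
    rintro x hx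
    exact (TameShift.neg_of_fixed hx fun φ hφ j => hφ.derivedMap_of_inner _).congr
      fun j => (smul_neg _ _).symm

theorem smul_comm_mem_innGroup {a b : Fin n} {p : MvPolynomial (Fin n) K} :
    p • comm K n a b ∈ innGroup K n ↔ (fun l => MvPolynomial.X l * p) ∈ mulGroup K a b := by
  have h : p • comm K n a b ∈ innGroup K n ↔
      TameMul (fun l => MvPolynomial.X l * p) (comm K n a b) := by
    have : (fun l : Fin n => (MvPolynomial.X l * p) • comm K n a b) =
        fun l => (MvPolynomial.X l : MvPolynomial (Fin n) K) • p • comm K n a b :=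
      funext fun l => mul_smul _ _ _
    rw [TameMul, this]
    rfl
  rw [h, mem_mulGroup]
  refine (and_iff_right ?_).symm
  rw [pairing]
  ring

theorem smul_comm_mem_innGroup_of_shear {a b p q : Fin n} {c : K} (hpq : q ≠ p)
    {f : MvPolynomial (Fin n) K} (h : f • comm K n a b ∈ innGroup K n) :
    shearAlg p q c f • (comm K n a b + (Pi.single p c : Fin n → K) a • comm K n q b +
          (Pi.single p c : Fin n → K) b • comm K n a q) ∈ innGroup K n := by
  obtain ⟨φ, hφ, h1⟩ := exists_isShear hpq c
  refine (TameShift.conj h hφ h1 hpq).congr fun j => ?_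
  simp only [h1.derivedMap_smul, h1.derivedMap_comm, shearAlg_X]
  rw [Pi.single_eq_of_ne hpq, zero_smul, add_zero, add_smul, smul_assoc]
  module

theorem inner_eq_pairVec_add_sum {a b : Fin n} (hab : a ≠ b) (p : MvPolynomial (Fin n) K) :
    (fun l => MvPolynomial.X l * p) = pairVec a b p +
      ∑ l ∈ {a, b}ᶜ, Pi.single l (MvPolynomial.X l * p) := by
  rw [pairVec, ← Finset.sum_pair (f := fun l => Pi.single l (MvPolynomial.X l * p)) hab,
    Finset.sum_add_sum_compl, Finset.univ_sum_single]

theorem smul_comm_mem_innGroup_of {a b : Fin n} (hab : a ≠ b) {p : MvPolynomial (Fin n) K}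
    (hp : pairVec a b p ∈ mulGroup K a b)
    (h : ∀ l, l ≠ a → l ≠ b → (MvPolynomial.X l * p) • comm K n a b ∈ cheinGroup K l) :
    p • comm K n a b ∈ innGroup K n := by
  rw [smul_comm_mem_innGroup, inner_eq_pairVec_add_sum hab]
  refine add_mem hp (sum_mem fun l hl => ?_)
  simp only [Finset.mem_compl, Finset.mem_insert, Finset.mem_singleton, not_or] at hl
  exact (single_mem_mulGroup (Ne.symm hl.1) (Ne.symm hl.2)).2 (h l hl.1 hl.2)

theorem X_mul_mem_of_mem_innGroup {i a b : Fin n} (hab : a ≠ b) (ha : a ≠ i) (hb : b ≠ i)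
    {p : MvPolynomial (Fin n) K} (hp : pairVec a b p ∈ mulGroup K a b)
    (h : ∀ l, l ≠ a → l ≠ b → l ≠ i → (MvPolynomial.X l * p) • comm K n a b ∈ cheinGroup K l)
    (hi : p • comm K n a b ∈ innGroup K n) :
    (MvPolynomial.X i * p) • comm K n a b ∈ cheinGroup K i := by
  have hmem : i ∈ ({a, b}ᶜ : Finset (Fin n)) := by
    simp [ha.symm, hb.symm]
  rw [smul_comm_mem_innGroup, inner_eq_pairVec_add_sum hab, ← Finset.add_sum_erase _ _ hmem] at hi
  rw [← single_mem_mulGroup ha hb]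
  have h1 : ∑ l ∈ ({a, b}ᶜ : Finset (Fin n)).erase i,
      (Pi.single l (MvPolynomial.X l * p) : Fin n → MvPolynomial (Fin n) K) ∈ mulGroup K a b := by
    refine sum_mem fun l hl => ?_
    simp only [Finset.mem_erase, Finset.mem_compl, Finset.mem_insert, Finset.mem_singleton,
      not_or] at hl
    exact (single_mem_mulGroup (Ne.symm hl.2.1) (Ne.symm hl.2.2)).2 (h l hl.2.1 hl.2.2 hl.1)
  convert sub_mem (sub_mem hi hp) h1 using 1
  abel

end Groups

section Core

theorem X_mul_mul_smul_comm_mem (hK : (4 ≤ n ∧ (3 : K) ≠ 0) ∨ 5 ≤ n) {i a b j : Fin n}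
    (ha : a ≠ i) (hb : b ≠ i) (hj : j ≠ i) (p h : MvPolynomial (Fin n) K) :
    (p * (MvPolynomial.X j * h)) • comm K n a b ∈ cheinGroup K i := by
  rw [mul_left_comm]
  exact X_mul_smul_comm_mem hK ha hb hj _

theorem pairVec_X_mul_mem (hK : (4 ≤ n ∧ (3 : K) ≠ 0) ∨ 5 ≤ n) {a b l m j : Fin n}
    (hla : l ≠ a) (hlb : l ≠ b) (hma : m ≠ a) (hmb : m ≠ b) (hja : j ≠ a) (hjb : j ≠ b)
    (h : MvPolynomial (Fin n) K) :
    pairVec a b (MvPolynomial.X j * h) ∈ mulGroup K l m :=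
  add_mem
    ((single_mem_mulGroup hla hma).2 (X_mul_mul_smul_comm_mem hK hla hma hja _ h))
    ((single_mem_mulGroup hlb hmb).2 (X_mul_mul_smul_comm_mem hK hlb hmb hjb _ h))

theorem X_cube_mul_smul_comm_mem (hK : (4 ≤ n ∧ (3 : K) ≠ 0) ∨ 5 ≤ n) {i a b k : Fin n}
    (ha : a ≠ i) (hb : b ≠ i) (hab : a ≠ b) (hki : k ≠ i) (hka : k ≠ a) (hkb : k ≠ b)
    (h : MvPolynomial (Fin n) K) :
    (MvPolynomial.X i * (MvPolynomial.X i * (MvPolynomial.X i * h))) • comm K n a b ∈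
      cheinGroup K i := by
  have hk : ∀ g : MvPolynomial (Fin n) K,
      pairVec a b (MvPolynomial.X k * (MvPolynomial.X i * g)) ∈ mulGroup K a b :=
    fun g => pairVec_mul_mem hab
      (pairVec_X_mul_mem hK ha.symm hb.symm hka hkb ha.symm hb.symm g) ha.symm hb.symm hki.symm
  have hi : ∀ g : MvPolynomial (Fin n) K,
      pairVec a b (MvPolynomial.X i * (MvPolynomial.X i * g)) ∈ mulGroup K a b :=
    fun g => pairVec_mul_mem hab
      (pairVec_X_mul_mem hK hka hkb ha.symm hb.symm ha.symm hb.symm g) hka hkb hki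
  have inn1 : ∀ g : MvPolynomial (Fin n) K,
      (MvPolynomial.X k * (MvPolynomial.X i * g)) • comm K n a b ∈ innGroup K n := by
    refine fun g => smul_comm_mem_innGroup_of hab (hk g) fun l hla hlb => ?_
    by_cases hlk : k = l
    · subst hlk
      rw [← mul_assoc]
      exact X_mul_mul_smul_comm_mem hK hla.symm hlb.symm hki.symm _ _
    · exact X_mul_mul_smul_comm_mem hK hla.symm hlb.symm hlk _ _
  refine X_mul_mem_of_mem_innGroup hab ha hb (hi h)
    (fun l hla hlb hli => X_mul_mul_smul_comm_mem hK hla.symm hlb.symm hli.symm _ _) ?_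
  obtain ⟨g, rfl⟩ : ∃ g, shearAlg k i 1 g = h := ⟨_, shearAlg_shearAlg_neg hki.symm 1 h⟩
  convert sub_mem (smul_comm_mem_innGroup_of_shear (p := k) (c := 1) hki.symm (inn1 g))
    (inn1 (shearAlg k i 1 g)) using 1
  rw [map_mul, map_mul, shearAlg_X, shearAlg_X, Pi.single_eq_same, Pi.single_eq_of_ne hki.symm,
    Pi.single_eq_of_ne hka.symm, Pi.single_eq_of_ne hkb.symm, one_smul, zero_smul, zero_smul,
    zero_smul]
  module

theorem single_add_single_mem_mulGroup (hK : (4 ≤ n ∧ (3 : K) ≠ 0) ∨ 5 ≤ n) {i a b k : Fin n}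
    (ha : a ≠ i) (hb : b ≠ i) (hki : k ≠ i) (hka : k ≠ a) (hkb : k ≠ b) (c d : K) :
    Pi.single i (MvPolynomial.C (d * c ^ 2) * MvPolynomial.X i ^ 2) -
      Pi.single k (MvPolynomial.C (d * c) * MvPolynomial.X k ^ 2) ∈ mulGroup K a b := by
  have h0 : Pi.single i (MvPolynomial.C d * MvPolynomial.X k ^ 2) ∈ mulGroup K a b := by
    rw [single_mem_mulGroup ha hb, MvPolynomial.C_mul_X_pow_eq_monomial]
    exact monomial_smul_comm_mem_cheinGroup ha hb (Finsupp.single_eq_of_ne hki.symm) d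
  have h1 : Pi.single i (MvPolynomial.C d *
        (MvPolynomial.X k + c • MvPolynomial.X i) ^ 2) -
      Pi.single k (MvPolynomial.C (c * d) * (MvPolynomial.X k + c • MvPolynomial.X i) ^ 2) ∈
        mulGroup K a b := by
    refine shear_mem_mulGroup (p := k) (q := i) (c := c) h0 hki.symm hka.symm hkb.symm
      fun l => ?_
    rw [Pi.single_eq_same, Pi.sub_apply]
    have hσ : shearAlg k i c (MvPolynomial.C d * MvPolynomial.X k ^ 2) =
        MvPolynomial.C d * (MvPolynomial.X k + c • MvPolynomial.X i) ^ 2 := by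
      rw [map_mul, map_pow, shearAlg_X, Pi.single_eq_same, ← MvPolynomial.algebraMap_eq,
        AlgHom.commutes]
    rw [hσ]
    by_cases hli : l = i
    · subst hli
      rw [Pi.single_eq_same, Pi.single_eq_same, Pi.single_eq_of_ne hki.symm,
        Pi.single_eq_of_ne hki.symm, zero_smul, hσ]
    · rw [Pi.single_eq_of_ne hli, Pi.single_eq_of_ne hli, map_zero, zero_sub, zero_sub]
      by_cases hlk : l = k
      · subst hlk
        rw [Pi.single_eq_same, Pi.single_eq_same, MvPolynomial.C_mul, MvPolynomial.smul_eq_C_mul,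
          MvPolynomial.smul_eq_C_mul, mul_assoc]
      · rw [Pi.single_eq_of_ne hlk, Pi.single_eq_of_ne hlk, zero_smul]
  have h2 : Pi.single i (MvPolynomial.X k * (MvPolynomial.C d * (MvPolynomial.X k +
      2 * MvPolynomial.C c * MvPolynomial.X i))) ∈ mulGroup K a b :=
    (single_mem_mulGroup ha hb).2 (X_mul_smul_comm_mem hK ha hb hki _)
  have h3 : Pi.single k (MvPolynomial.X i * (MvPolynomial.C (c * d) *
      (2 * MvPolynomial.C c * MvPolynomial.X k + MvPolynomial.C c ^ 2 * MvPolynomial.X i))) ∈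
      mulGroup K a b :=
    (single_mem_mulGroup hka.symm hkb.symm).2
      (X_mul_smul_comm_mem hK hka.symm hkb.symm hki.symm _)
  convert add_mem (sub_mem h1 h2) h3 using 1
  funext l
  simp only [Pi.add_apply, Pi.sub_apply, Pi.single_apply, MvPolynomial.C_mul,
    MvPolynomial.C_pow, MvPolynomial.smul_eq_C_mul]
  split_ifs <;> ring

theorem C_mul_X_sq_smul_comm_mem_of_ne (hK : (4 ≤ n ∧ (3 : K) ≠ 0) ∨ 5 ≤ n) {i a b k : Fin n}
    (ha : a ≠ i) (hb : b ≠ i) (hki : k ≠ i) (hka : k ≠ a) (hkb : k ≠ b) {α : K}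
    (h0 : α ≠ 0) (h1 : α ≠ 1) (d : K) :
    (MvPolynomial.C d * MvPolynomial.X i ^ 2) • comm K n a b ∈ cheinGroup K i := by
  have h1' : α - 1 ≠ 0 := sub_ne_zero.2 h1
  rw [← single_mem_mulGroup ha hb]
  convert sub_mem
    (single_add_single_mem_mulGroup hK ha hb hki hka hkb α (d / (α - 1) / α))
    (single_add_single_mem_mulGroup hK ha hb hki hka hkb 1 (d / (α - 1))) using 1
  have e1 : d / (α - 1) / α * α = d / (α - 1) * 1 := by field_simp
  have e2 : d = d / (α - 1) / α * α ^ 2 - d / (α - 1) * 1 ^ 2 := by field_simp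
  rw [e1, sub_sub_sub_cancel_right, ← Pi.single_sub, ← sub_mul, ← MvPolynomial.C_sub, ← e2]

theorem pairVec_one_mem (h2 : (2 : K) = 0) {a b l m : Fin n} (hab : a ≠ b)
    (hla : l ≠ a) (hlb : l ≠ b) (hma : m ≠ a) (hmb : m ≠ b) :
    pairVec a b 1 ∈ mulGroup K l m := by
  have hX : ∀ {p q : Fin n}, q ≠ p → l ≠ p → m ≠ p →
      Pi.single p (MvPolynomial.X q) ∈ mulGroup K l m := fun {p q} hq hl hm => by
    rw [single_mem_mulGroup hl hm]
    exact monomial_smul_comm_mem_cheinGroup hl hm (Finsupp.single_eq_of_ne hq.symm) 1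
  have hneg : ∀ p : MvPolynomial (Fin n) K, -p = p := fun p => by
    have : (2 : MvPolynomial (Fin n) K) = 0 := by
      rw [← map_ofNat (MvPolynomial.C (σ := Fin n) (R := K)) 2]
      exact (congrArg _ h2).trans (map_zero _)
    linear_combination (-p) * this
  have h : Pi.single a (MvPolynomial.X a + MvPolynomial.X b) +
      Pi.single b (MvPolynomial.X a + MvPolynomial.X b) ∈ mulGroup K l m := by
    refine shear_mem_mulGroup (p := a) (q := b) (c := 1) (hX hab hlb hmb) hab.symm hla hma
      fun j => ?_
    rw [Pi.single_eq_same, shearAlg_X, Pi.single_eq_same, one_smul, Pi.add_apply]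
    by_cases hja : j = a
    · subst hja
      rw [Pi.single_eq_same, Pi.single_eq_same, Pi.single_eq_of_ne hab, Pi.single_eq_of_ne hab,
        map_zero, zero_sub, one_smul, hneg, add_zero]
    · rw [Pi.single_eq_of_ne hja, Pi.single_eq_of_ne hja, zero_smul, zero_add, sub_zero]
      by_cases hjb : j = b
      · subst hjb
        rw [Pi.single_eq_same, Pi.single_eq_same, shearAlg_X, Pi.single_eq_same, one_smul]
      · rw [Pi.single_eq_of_ne hjb, Pi.single_eq_of_ne hjb, map_zero]
  convert sub_mem (sub_mem h (hX hab.symm hla hma)) (hX hab hlb hmb) using 1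
  funext j
  simp only [pairVec, Pi.add_apply, Pi.sub_apply, Pi.single_apply]
  split_ifs <;> ring

theorem X_smul_comm_mem_innGroup (hK : (4 ≤ n ∧ (3 : K) ≠ 0) ∨ 5 ≤ n) (h2 : (2 : K) = 0)
    {a b : Fin n} (hab : a ≠ b) :
    (MvPolynomial.X a : MvPolynomial (Fin n) K) • comm K n a b ∈ innGroup K n := by
  have hn : 4 ≤ n := by omega
  obtain ⟨i, hi⟩ := exists_ne_of_card ({a, b} : Finset (Fin n))
    (lt_of_le_of_lt Finset.card_le_two (by omega))
  obtain ⟨k, hk⟩ := exists_ne_of_card ({i, a, b} : Finset (Fin n))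
    (lt_of_le_of_lt Finset.card_le_three (by omega))
  simp only [Finset.mem_insert, Finset.mem_singleton, not_or, ← ne_eq] at hi hk
  obtain ⟨hia, hib⟩ := hi
  obtain ⟨hki, hka, hkb⟩ := hk
  have h1 : pairVec a b (MvPolynomial.X i) ∈ mulGroup K a b := by
    rw [← mul_one (MvPolynomial.X i)]
    exact pairVec_mul_mem hab (pairVec_one_mem h2 hab hka hkb hia hib) hka hkb hki
  have h3 : pairVec a b (MvPolynomial.X i + MvPolynomial.X a) -
      Pi.single i (MvPolynomial.X a * (MvPolynomial.X i + MvPolynomial.X a)) ∈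
      mulGroup K a b := by
    refine shear_mem_mulGroup (p := i) (q := a) (c := 1) h1 hia.symm hia.symm hib.symm
      fun j => ?_
    simp only [pairVec, Pi.add_apply, Pi.sub_apply]
    have hσa : shearAlg i a (1 : K) (MvPolynomial.X a) = MvPolynomial.X a := by
      rw [shearAlg_X, Pi.single_eq_of_ne hia.symm, zero_smul, add_zero]
    have hσb : shearAlg i a (1 : K) (MvPolynomial.X b) = MvPolynomial.X b := by
      rw [shearAlg_X, Pi.single_eq_of_ne hib.symm, zero_smul, add_zero]
    have hσi : shearAlg i a (1 : K) (MvPolynomial.X i) =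
        MvPolynomial.X i + MvPolynomial.X a := by
      rw [shearAlg_X, Pi.single_eq_same, one_smul]
    by_cases hja : j = a
    · subst hja
      simp [Pi.single_eq_of_ne hab, Pi.single_eq_of_ne hia.symm, hσa, hσi]
    by_cases hjb : j = b
    · subst hjb
      simp [Pi.single_eq_of_ne hab.symm, Pi.single_eq_of_ne hib.symm, hσb, hσi]
    by_cases hji : j = i
    · subst hji
      simp [Pi.single_eq_of_ne hab, Pi.single_eq_of_ne hia, Pi.single_eq_of_ne hib, hσa, hσi]
    simp [Pi.single_eq_of_ne hja, Pi.single_eq_of_ne hjb, Pi.single_eq_of_ne hji]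
  have h4 : Pi.single i (MvPolynomial.X a * (MvPolynomial.X i + MvPolynomial.X a)) ∈
      mulGroup K a b :=
    (single_mem_mulGroup hia.symm hib.symm).2
      (X_mul_smul_comm_mem hK hia.symm hib.symm hia.symm _)
  refine smul_comm_mem_innGroup_of hab ?_ fun l hla hlb => ?_
  · convert sub_mem (add_mem h3 h4) h1 using 1
    funext j
    simp only [pairVec, Pi.add_apply, Pi.sub_apply, Pi.single_apply]
    split_ifs <;> ring
  · rw [mul_comm]
    exact X_mul_smul_comm_mem hK hla.symm hlb.symm hla.symm _

theorem X_sq_smul_comm_mem_of_two (hK : (4 ≤ n ∧ (3 : K) ≠ 0) ∨ 5 ≤ n) (h2 : (2 : K) = 0)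
    {i a b k : Fin n} (ha : a ≠ i) (hb : b ≠ i) (hab : a ≠ b) (hki : k ≠ i) (hka : k ≠ a)
    (hkb : k ≠ b) :
    ((MvPolynomial.X i : MvPolynomial (Fin n) K) ^ 2) • comm K n a b ∈ cheinGroup K i := by
  have hp : pairVec a b (MvPolynomial.X i) ∈ mulGroup K a b := by
    rw [← mul_one (MvPolynomial.X i)]
    exact pairVec_mul_mem hab (pairVec_one_mem h2 hab hka hkb ha.symm hb.symm) hka hkb hki
  rw [pow_two]
  refine X_mul_mem_of_mem_innGroup hab ha hb hp (fun l hla hlb hli => ?_) ?_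
  · rw [mul_comm]
    exact X_mul_smul_comm_mem hK hla.symm hlb.symm hli.symm _
  have hb' : ∀ {p q : Fin n}, p ≠ q →
      (MvPolynomial.X q : MvPolynomial (Fin n) K) • comm K n p q ∈ innGroup K n :=
    fun {p q} hpq => by
      rw [comm_skew q p, smul_neg]
      exact neg_mem (X_smul_comm_mem_innGroup hK h2 hpq.symm)
  have h3 : (3 * (MvPolynomial.X i * 1 : MvPolynomial (Fin n) K)) • comm K n a b ∈
      innGroup K n := by
    refine three_smul_X_mul_smul_comm_mem ?_ ?_
    · have e1 := smul_comm_mem_innGroup_of_shear (p := a) (q := i) (c := 1) ha.symm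
        (X_smul_comm_mem_innGroup hK h2 hab)
      convert sub_mem (sub_mem e1 (X_smul_comm_mem_innGroup hK h2 hab))
        (X_smul_comm_mem_innGroup hK h2 hb.symm) using 1
      rw [shearAlg_X, Pi.single_eq_same, Pi.single_eq_of_ne hab.symm]
      simp only [one_smul]
      module
    · have e1 := smul_comm_mem_innGroup_of_shear (p := b) (q := i) (c := 1) hb.symm (hb' hab)
      convert sub_mem (sub_mem e1 (hb' hab)) (hb' ha) using 1
      rw [shearAlg_X, Pi.single_eq_same, Pi.single_eq_of_ne hab]
      simp only [one_smul]
      module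
  convert h3 using 2
  have : (2 : MvPolynomial (Fin n) K) = 0 := by
    rw [← map_ofNat (MvPolynomial.C (σ := Fin n) (R := K)) 2]
    exact (congrArg _ h2).trans (map_zero _)
  linear_combination (-MvPolynomial.X i) * this

theorem monomial_smul_comm_mem (hK : (4 ≤ n ∧ (3 : K) ≠ 0) ∨ 5 ≤ n) {i a b : Fin n}
    (ha : a ≠ i) (hb : b ≠ i) {d : Fin n →₀ ℕ} (hd : 2 ≤ d.degree) (c : K) :
    MvPolynomial.monomial d c • comm K n a b ∈ cheinGroup K i := by
  by_cases hab : a = b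
  · rw [hab, comm_self, smul_zero]
    exact zero_mem _
  by_cases hj : ∃ j, j ≠ i ∧ d j ≠ 0
  · obtain ⟨j, hji, hdj⟩ := hj
    have h1 : Finsupp.single j 1 ≤ d := by
      rw [Finsupp.single_le_iff]
      omega
    have h2 := X_mul_smul_comm_mem hK ha hb hji (MvPolynomial.monomial (d - Finsupp.single j 1) c)
    rwa [MvPolynomial.X, MvPolynomial.monomial_mul, one_mul, add_tsub_cancel_of_le h1] at h2
  · push Not at hj
    obtain ⟨k, hk⟩ := exists_ne_of_card ({i, a, b} : Finset (Fin n))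
      (lt_of_le_of_lt Finset.card_le_three (by omega))
    simp only [Finset.mem_insert, Finset.mem_singleton, not_or, ← ne_eq] at hk
    obtain ⟨hki, hka, hkb⟩ := hk
    obtain ⟨m, rfl⟩ : ∃ m, d = Finsupp.single i m := by
      refine ⟨d i, Finsupp.ext fun j => ?_⟩
      by_cases hji : j = i
      · rw [hji, Finsupp.single_eq_same]
      · rw [hj j hji, Finsupp.single_eq_of_ne hji]
    rw [Finsupp.degree_single] at hd
    rw [← MvPolynomial.C_mul_X_pow_eq_monomial]
    obtain rfl | ⟨l, rfl⟩ : m = 2 ∨ ∃ l, m = l + 3 := by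
      rcases hd.eq_or_lt with h | h
      · exact Or.inl h.symm
      · exact Or.inr ⟨m - 3, by omega⟩
    · by_cases hα : ∃ α : K, α ≠ 0 ∧ α ≠ 1
      · obtain ⟨α, h0, h1⟩ := hα
        exact C_mul_X_sq_smul_comm_mem_of_ne hK ha hb hki hka hkb h0 h1 c
      · push Not at hα
        have h2 : (2 : K) = 0 := by
          by_contra h
          have := hα 2 h
          exact one_ne_zero (α := K) (by linear_combination this)
        by_cases hc : c = 0
        · rw [hc, map_zero, zero_mul, zero_smul]
          exact zero_mem _
        · rw [hα c hc, map_one, one_mul]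
          exact X_sq_smul_comm_mem_of_two hK h2 ha hb hab hki hka hkb
    · have h := X_cube_mul_smul_comm_mem hK ha hb hab hki hka hkb
        (MvPolynomial.C c * MvPolynomial.X i ^ l)
      convert h using 2
      ring

end Core

/-- Pairs of polynomials, with the metabelian bracket `⁅(a, u), (b, v)⁆ = (0, b u - a v)`. -/
@[ext]
structure AffineLie (K : Type) [Field K] (n : ℕ) where
  /-- The abelian quotient component. -/
  base : MvPolynomial (Fin n) K
  /-- The component in the derived ideal. -/
  fib : MvPolynomial (Fin n) K

namespace AffineLie

/-- The underlying additive equivalence with pairs. -/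
def equivProd : AffineLie K n ≃ MvPolynomial (Fin n) K × MvPolynomial (Fin n) K where
  toFun x := (x.base, x.fib)
  invFun x := ⟨x.1, x.2⟩

instance : AddCommGroup (AffineLie K n) := equivProd.addCommGroup

instance : Module K (AffineLie K n) := equivProd.module K

@[simp] theorem base_zero : (0 : AffineLie K n).base = 0 := rfl
@[simp] theorem fib_zero : (0 : AffineLie K n).fib = 0 := rfl
@[simp] theorem base_add (x y : AffineLie K n) : (x + y).base = x.base + y.base := rfl
@[simp] theorem fib_add (x y : AffineLie K n) : (x + y).fib = x.fib + y.fib := rfl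
@[simp] theorem base_smul (c : K) (x : AffineLie K n) : (c • x).base = c • x.base := rfl
@[simp] theorem fib_smul (c : K) (x : AffineLie K n) : (c • x).fib = c • x.fib := rfl

instance : Bracket (AffineLie K n) (AffineLie K n) :=
  ⟨fun x y => ⟨0, y.base * x.fib - x.base * y.fib⟩⟩

@[simp] theorem base_lie (x y : AffineLie K n) : ⁅x, y⁆.base = 0 := rfl
@[simp] theorem fib_lie (x y : AffineLie K n) :
    ⁅x, y⁆.fib = y.base * x.fib - x.base * y.fib := rfl

instance : LieRing (AffineLie K n) where
  add_lie x y z := by ext1 <;> simp; ring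
  lie_add x y z := by ext1 <;> simp; ring
  lie_self x := by ext1 <;> simp
  leibniz_lie x y z := by ext1 <;> simp; ring

instance : LieAlgebra K (AffineLie K n) where
  lie_smul c x y := by ext1 <;> simp [MvPolynomial.smul_eq_C_mul]; ring

theorem lie_lie_lie_eq_zero (a b c d : AffineLie K n) : ⁅⁅a, b⁆, ⁅c, d⁆⁆ = 0 := by
  ext1
  · rfl
  · simp only [fib_lie, base_lie, zero_mul, sub_self, fib_zero]

end AffineLie

section FoxDerivative

theorem exists_foxHom (K : Type) [Field K] {n : ℕ} (i : Fin n) :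
    ∃ D : FreeMetabelianLie K n →ₗ⁅K⁆ AffineLie K n,
      ∀ j, D (xg K n j) = ⟨MvPolynomial.X j, (Pi.single i 1 : Fin n → MvPolynomial (Fin n) K) j⟩ :=
  exists_lift AffineLie.lie_lie_lie_eq_zero _

/-- The Lie homomorphism encoding the partial Fox derivative with respect to `xᵢ`. -/
def foxHom (K : Type) [Field K] {n : ℕ} (i : Fin n) :
    FreeMetabelianLie K n →ₗ⁅K⁆ AffineLie K n :=
  (exists_foxHom K i).choose

theorem foxHom_xg (i j : Fin n) : foxHom K i (xg K n j) =
    ⟨MvPolynomial.X j, (Pi.single i 1 : Fin n → MvPolynomial (Fin n) K) j⟩ :=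
  (exists_foxHom K i).choose_spec j

/-- The partial Fox derivative with respect to `xᵢ` on the derived ideal. -/
def fox (K : Type) [Field K] {n : ℕ} (i : Fin n) :
    Derived K n →ₗ[K] MvPolynomial (Fin n) K where
  toFun z := (foxHom K i z).fib
  map_add' x y := by
    change (foxHom K i ((x : FreeMetabelianLie K n) + y)).fib = _
    rw [map_add, AffineLie.fib_add]
  map_smul' c x := by
    change (foxHom K i (c • (x : FreeMetabelianLie K n))).fib = _
    rw [map_smul, AffineLie.fib_smul, RingHom.id_apply]

theorem foxHom_smul {i : Fin n} {z : Derived K n} (hz : (foxHom K i z).base = 0)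
    (p : MvPolynomial (Fin n) K) :
    (foxHom K i (p • z : Derived K n)).base = 0 ∧ fox K i (p • z) = p * fox K i z := by
  induction p using MvPolynomial.induction_on generalizing z with
  | C c =>
    rw [C_smul, map_smul, MvPolynomial.smul_eq_C_mul]
    refine ⟨?_, rfl⟩
    change (foxHom K i (c • (z : FreeMetabelianLie K n))).base = 0
    rw [map_smul, AffineLie.base_smul, hz, smul_zero]
  | add p q hp hq =>
    rw [add_smul, map_add, (hp hz).2, (hq hz).2, add_mul]
    refine ⟨?_, rfl⟩
    change (foxHom K i (((p • z : Derived K n) : FreeMetabelianLie K n) +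
      (q • z : Derived K n))).base = 0
    rw [map_add, AffineLie.base_add, (hp hz).1, (hq hz).1, add_zero]
  | mul_X p j hp =>
    have h : foxHom K i ((MvPolynomial.X j : MvPolynomial (Fin n) K) • z : Derived K n) =
        ⟨0, MvPolynomial.X j * fox K i z⟩ := by
      rw [X_smul, LieHom.map_lie, foxHom_xg]
      ext1
      · simp
      · simp [hz, fox]
    rw [mul_smul]
    obtain ⟨h1, h2⟩ := hp (congrArg AffineLie.base h)
    refine ⟨h1, ?_⟩
    rw [h2, show fox K i ((MvPolynomial.X j : MvPolynomial (Fin n) K) • z) = _ from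
      congrArg AffineLie.fib h, mul_assoc]

theorem foxHom_comm (i a b : Fin n) : foxHom K i (comm K n a b) =
    ⟨0, MvPolynomial.X b * (Pi.single i 1 : Fin n → MvPolynomial (Fin n) K) a -
      MvPolynomial.X a * (Pi.single i 1 : Fin n → MvPolynomial (Fin n) K) b⟩ := by
  change foxHom K i ⁅xg K n a, xg K n b⁆ = _
  rw [LieHom.map_lie, foxHom_xg, foxHom_xg]
  rfl

theorem fox_smul_comm (i a b : Fin n) (p : MvPolynomial (Fin n) K) :
    fox K i (p • comm K n a b) =
      p * (MvPolynomial.X b * (Pi.single i 1 : Fin n → MvPolynomial (Fin n) K) a -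
        MvPolynomial.X a * (Pi.single i 1 : Fin n → MvPolynomial (Fin n) K) b) := by
  have h := foxHom_comm (K := K) i a b
  rw [(foxHom_smul (congrArg AffineLie.base h) p).2]
  exact congrArg _ (congrArg AffineLie.fib h)

/-- The span of the Lie monomials of degree at least four. -/
def highSpan (K : Type) [Field K] (n : ℕ) : Submodule K (Derived K n) :=
  Submodule.span K {z | ∃ (d : Fin n →₀ ℕ) (a b : Fin n), 2 ≤ d.degree ∧
    z = MvPolynomial.monomial d (1 : K) • comm K n a b}

theorem foxHom_of_mem_highSpan {i : Fin n} {z : Derived K n} (hz : z ∈ highSpan K n) :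
    (foxHom K i z).base = 0 ∧ MvPolynomial.constantCoeff (fox K i z) = 0 := by
  induction hz using Submodule.span_induction with
  | mem z hz =>
    obtain ⟨d, a, b, -, rfl⟩ := hz
    refine ⟨(foxHom_smul (congrArg AffineLie.base (foxHom_comm i a b)) _).1, ?_⟩
    rw [fox_smul_comm]
    simp
  | zero => exact ⟨by simp, by simp⟩
  | add x y _ _ hx hy =>
    refine ⟨?_, by rw [map_add, map_add, hx.2, hy.2, add_zero]⟩
    rw [Submodule.coe_add, map_add, AffineLie.base_add, hx.1, hy.1, add_zero]
  | smul c x _ hx =>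
    refine ⟨?_, by rw [map_smul, MvPolynomial.smul_eq_C_mul, map_mul, hx.2, mul_zero]⟩
    rw [Submodule.coe_smul, map_smul, AffineLie.base_smul, hx.1, smul_zero]

theorem fox_eq_zero_of_isShift {i : Fin n} {m : Derived K n} (hm : m ∈ highSpan K n)
    {φ : FreeMetabelianLie K n ≃ₗ⁅K⁆ FreeMetabelianLie K n} (h : IsShift φ (Pi.single i m)) :
    fox K i m = 0 := by
  obtain ⟨hbase, hconst⟩ := foxHom_of_mem_highSpan (i := i) hm
  have key : ∀ z, (foxHom K i (φ z)).base = (foxHom K i z).base ∧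
      (foxHom K i (φ z)).fib = (1 + fox K i m) * (foxHom K i z).fib := by
    intro z
    induction z using xg_induction with
    | gen j =>
      rw [h j, map_add, foxHom_xg]
      by_cases hj : j = i
      · subst hj
        simp only [Pi.single_eq_same, AffineLie.base_add, AffineLie.fib_add, hbase]
        exact ⟨add_zero _, (mul_one _).symm⟩
      · simp [Pi.single_eq_of_ne hj]
    | zero => simp
    | add a b ha hb => simp [ha.1, ha.2, hb.1, hb.2, mul_add]
    | smul c a ha => simp [ha.1, ha.2]
    | lie a b ha hb =>
      simp only [LieEquiv.map_lie, LieHom.map_lie, AffineLie.base_lie, AffineLie.fib_lie, ha.1,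
        ha.2, hb.1, hb.2, true_and]
      ring
  have h1 := (key (φ.symm (xg K n i))).2
  rw [φ.apply_symm_apply, foxHom_xg, Pi.single_eq_same] at h1
  have hu : IsUnit (1 + fox K i m) := IsUnit.of_mul_eq_one _ h1.symm
  obtain ⟨r, -, hr⟩ := MvPolynomial.isUnit_iff_eq_C_of_isReduced.1 hu
  have h2 := congrArg MvPolynomial.constantCoeff hr
  rw [map_add, map_one, hconst, add_zero, MvPolynomial.constantCoeff_C] at h2
  rw [← h2, MvPolynomial.C_1] at hr
  exact add_eq_left.1 hr

open Classical in
/-- A section of the Fox derivative on monomials. -/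
def foxSection (K : Type) [Field K] {n : ℕ} (i : Fin n) :
    MvPolynomial (Fin n) K →ₗ[K] Derived K n :=
  (MvPolynomial.basisMonomials (Fin n) K).constr K fun d =>
    if h : ∃ k, k ≠ i ∧ d k ≠ 0 then
      MvPolynomial.monomial (d - Finsupp.single h.choose 1) (1 : K) • comm K n i h.choose
    else 0

theorem exists_foxSection_monomial {i : Fin n} {d : Fin n →₀ ℕ} (h : ∃ k, k ≠ i ∧ d k ≠ 0) :
    ∃ k, k ≠ i ∧ d k ≠ 0 ∧ foxSection K i (MvPolynomial.monomial d 1) =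
      MvPolynomial.monomial (d - Finsupp.single k 1) (1 : K) • comm K n i k := by
  refine ⟨h.choose, h.choose_spec.1, h.choose_spec.2, ?_⟩
  have h1 := congrFun (MvPolynomial.coe_basisMonomials (Fin n) K) d
  rw [foxSection, ← h1, Module.Basis.constr_basis, dif_pos h]

theorem sub_foxSection_mem {i : Fin n} {W : Submodule K (Derived K n)}
    (hW : ∀ (d : Fin n →₀ ℕ) (a b : Fin n), a ≠ i → b ≠ i → 2 ≤ d.degree →
      MvPolynomial.monomial d (1 : K) • comm K n a b ∈ W)
    {m : Derived K n} (hm : m ∈ highSpan K n) : m - foxSection K i (fox K i m) ∈ W := by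
  have hib : ∀ (d : Fin n →₀ ℕ) (b : Fin n), b ≠ i → 2 ≤ d.degree →
      MvPolynomial.monomial d (1 : K) • comm K n i b -
        foxSection K i (fox K i (MvPolynomial.monomial d (1 : K) • comm K n i b)) ∈ W := by
    intro d b hb hd
    have h1 : fox K i (MvPolynomial.monomial d (1 : K) • comm K n i b) =
        MvPolynomial.monomial (d + Finsupp.single b 1) 1 := by
      rw [fox_smul_comm, Pi.single_eq_same, Pi.single_eq_of_ne hb, mul_one, mul_zero, sub_zero,
        MvPolynomial.X, MvPolynomial.monomial_mul, mul_one]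
    obtain ⟨k, hki, hdk, hk⟩ := exists_foxSection_monomial (K := K) (i := i)
      (d := d + Finsupp.single b 1) ⟨b, hb, by simp⟩
    rw [h1, hk]
    by_cases hkb : k = b
    · rw [hkb, add_tsub_cancel_right, sub_self]
      exact W.zero_mem
    · rw [Finsupp.add_apply, Finsupp.single_eq_of_ne hkb, add_zero] at hdk
      obtain ⟨e, rfl⟩ : ∃ e, d = e + Finsupp.single k 1 := by
        refine ⟨d - Finsupp.single k 1, (tsub_add_cancel_of_le ?_).symm⟩
        rw [Finsupp.single_le_iff]
        omega
      have h2 := hW (e + Finsupp.single i 1) k b hki hb (by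
        rw [map_add, Finsupp.degree_single] at hd ⊢
        exact hd)
      rw [add_right_comm, add_tsub_cancel_right]
      convert h2 using 1
      have hX : ∀ j : Fin n, MvPolynomial.monomial (e + Finsupp.single j 1) (1 : K) =
          MvPolynomial.monomial e 1 * MvPolynomial.X j := fun j => by
        rw [MvPolynomial.X, MvPolynomial.monomial_mul, mul_one]
      have hj := jacobi (K := K) i k b
      rw [comm_skew i b] at hj
      rw [hX, hX, hX]
      linear_combination (norm := module) (-MvPolynomial.monomial e (1 : K)) • hj
  refine Submodule.span_le (p := W.comap (LinearMap.id - foxSection K i ∘ₗ fox K i)) |>.2 ?_ hm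
  rintro _ ⟨d, a, b, hd, rfl⟩
  change MvPolynomial.monomial d (1 : K) • comm K n a b -
    foxSection K i (fox K i (MvPolynomial.monomial d (1 : K) • comm K n a b)) ∈ W
  by_cases ha : a = i
  · subst ha
    by_cases hb : b = a
    · subst hb
      rw [comm_self, smul_zero, map_zero, map_zero, sub_zero]
      exact W.zero_mem
    · exact hib d b hb hd
  · by_cases hb : b = i
    · subst hb
      rw [comm_skew b a, smul_neg, map_neg, map_neg, ← neg_sub']
      exact W.neg_mem (hib d a ha hd)
    · rw [fox_smul_comm, Pi.single_eq_of_ne ha, Pi.single_eq_of_ne hb, mul_zero, mul_zero,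
        sub_zero, mul_zero, map_zero, sub_zero]
      exact hW d a b ha hb hd

end FoxDerivative

section Grading

theorem exists_of_mem_monoSet {k : ℕ} {u : FreeMetabelianLie K n} (hu : u ∈ monoSet K n (k + 1)) :
    ∃ (d : Fin n →₀ ℕ) (a b : Fin n), d.degree = k ∧
      u = (MvPolynomial.monomial d (1 : K) • comm K n a b : Derived K n) := by
  induction k generalizing u with
  | zero =>
    obtain ⟨_, ⟨a, rfl⟩, b, rfl⟩ := hu
    refine ⟨0, a, b, map_zero _, ?_⟩
    rw [← MvPolynomial.C_apply, MvPolynomial.C_1, one_smul]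
    rfl
  | succ k ih =>
    obtain ⟨u, hu, j, rfl⟩ := hu
    obtain ⟨d, a, b, hd, rfl⟩ := ih hu
    refine ⟨Finsupp.single j 1 + d, a, b, ?_, ?_⟩
    · rw [map_add, Finsupp.degree_single, hd, add_comm]
    · rw [← X_smul, smul_smul, MvPolynomial.X, MvPolynomial.monomial_mul, one_mul]

theorem exists_of_mem_gradePiece {x : FreeMetabelianLie K n}
    (hx : x ∈ gradePiece K n 1 ⊔ ⨆ (k : ℕ) (_ : 4 ≤ k), gradePiece K n k) :
    ∃ (c : Fin n → K) (m : Derived K n), m ∈ highSpan K n ∧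
      x = ∑ j, c j • xg K n j + m := by
  obtain ⟨y, hy, z, hz, rfl⟩ := Submodule.mem_sup.1 hx
  obtain ⟨c, rfl⟩ := (Submodule.mem_span_range_iff_exists_fun K).1
    (show y ∈ Submodule.span K (Set.range (xg K n)) from hy)
  have hle : ⨆ (k : ℕ) (_ : 4 ≤ k), gradePiece K n k ≤
      (highSpan K n).map
        (LieAlgebra.derivedSeries K (FreeMetabelianLie K n) 1).toSubmodule.subtype := by
    refine iSup₂_le fun k hk => Submodule.span_le.2 fun u hu => ?_
    obtain ⟨l, rfl⟩ : ∃ l, k = l + 2 := ⟨k - 2, by omega⟩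
    obtain ⟨d, a, b, hd, rfl⟩ := exists_of_mem_monoSet hu
    exact ⟨_, Submodule.subset_span ⟨d, a, b, by omega, rfl⟩, rfl⟩
  obtain ⟨m, hm, rfl⟩ := hle hz
  exact ⟨c, m, hm, rfl⟩

/-- The largest `K`-subspace contained in `cheinGroup K i`. -/
def cheinSubmodule (K : Type) [Field K] {n : ℕ} (i : Fin n) : Submodule K (Derived K n) where
  carrier := {m | ∀ c : K, c • m ∈ cheinGroup K i}
  zero_mem' c := by
    rw [smul_zero]
    exact zero_mem _
  add_mem' ha hb c := by
    rw [smul_add]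
    exact add_mem (ha c) (hb c)
  smul_mem' c x hx c' := by
    rw [smul_smul]
    exact hx _

theorem isTame_of_isShift_single (hK : (4 ≤ n ∧ (3 : K) ≠ 0) ∨ 5 ≤ n) {i : Fin n}
    {m : Derived K n} (hm : m ∈ highSpan K n)
    {φ : FreeMetabelianLie K n ≃ₗ⁅K⁆ FreeMetabelianLie K n} (h : IsShift φ (Pi.single i m)) :
    IsTame K n φ := by
  have h1 : m - foxSection K i (fox K i m) ∈ cheinSubmodule K i := by
    refine sub_foxSection_mem (fun d a b ha hb hd c => ?_) hm
    rw [← C_smul, smul_smul, MvPolynomial.C_mul_monomial, mul_one]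
    exact monomial_smul_comm_mem hK ha hb hd c
  rw [fox_eq_zero_of_isShift hm h, map_zero, sub_zero] at h1
  have h2 := h1 1
  rw [one_smul] at h2
  obtain ⟨ψ, hψ, hψ'⟩ := h2.2
  rwa [equiv_ext fun j => (h j).trans (hψ' j).symm]

theorem coeff_ne_zero {i : Fin n} {φ : FreeMetabelianLie K n ≃ₗ⁅K⁆ FreeMetabelianLie K n}
    (hφ : ∀ j ≠ i, φ (xg K n j) = xg K n j) {c : Fin n → K} {m : Derived K n}
    (h : φ (xg K n i) = ∑ j, c j • xg K n j + m) : c i ≠ 0 := by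
  intro hc
  let _ : LieRing K := LieRing.ofAssociativeRing
  let _ : LieAlgebra K K := LieAlgebra.ofAssociativeAlgebra
  have hK0 : ∀ x y : K, ⁅x, y⁆ = 0 := fun x y => by rw [Ring.lie_def, mul_comm, sub_self]
  obtain ⟨F, hF⟩ := exists_lift (K := K) (L := K) (fun a b c d => by rw [hK0 ⁅a, b⁆])
    (Pi.single i (1 : K))
  have hFm : ∀ z ∈ LieAlgebra.derivedSeries K (FreeMetabelianLie K n) 1, F z = 0 := by
    intro z hz
    have hbot : LieAlgebra.derivedSeries K K 1 = ⊥ := by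
      rw [LieAlgebra.derivedSeries_def, LieAlgebra.derivedSeriesOfIdeal_succ,
        LieSubmodule.lie_eq_bot_iff]
      exact fun x _ y _ => hK0 x y
    have h1 := LieIdeal.derivedSeries_map_le (f := F) 1 (LieIdeal.mem_map hz)
    rwa [hbot, LieSubmodule.mem_bot] at h1
  have key : ∀ z, F (φ z) = 0 := fun z => by
    refine hom_ext (F := F.comp φ.toLieHom) (G := 0) (fun j => ?_) z
    change F (φ (xg K n j)) = 0
    by_cases hj : j = i
    · rw [hj, h, map_add, hFm _ m.2, add_zero, map_sum]
      refine Finset.sum_eq_zero fun l _ => ?_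
      rw [map_smul, hF]
      by_cases hl : l = i
      · rw [hl, hc, zero_smul]
      · rw [Pi.single_eq_of_ne hl, smul_zero]
    · rw [hφ j hj, hF, Pi.single_eq_of_ne hj]
  have h1 := key (φ.symm (xg K n i))
  rw [φ.apply_symm_apply, hF, Pi.single_eq_same] at h1
  exact one_ne_zero h1

theorem isTame_of_isCheinAut (hK : (4 ≤ n ∧ (3 : K) ≠ 0) ∨ 5 ≤ n)
    {φ : FreeMetabelianLie K n ≃ₗ⁅K⁆ FreeMetabelianLie K n} (hchein : IsCheinAut K n φ)
    (hdeg : AutLdegGE K n φ 4) : IsTame K n φ := by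
  obtain ⟨i, hφ⟩ := hchein
  obtain ⟨c, m, hm, h⟩ := exists_of_mem_gradePiece (hdeg i)
  have hc := coeff_ne_zero hφ h
  rw [← Finset.add_sum_erase _ _ (Finset.mem_univ i)] at h
  set g := ∑ j ∈ Finset.univ.erase i, c j • xg K n j with hg
  have hφg : φ g = g := by
    rw [hg, map_sum]
    refine Finset.sum_congr rfl fun j hj => ?_
    rw [map_smul, hφ j (Finset.ne_of_mem_erase hj)]
  have hgmem : -((c i)⁻¹ • g) ∈
      LieSubalgebra.lieSpan K (FreeMetabelianLie K n) (xg K n '' {j | j ≠ i}) :=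
    neg_mem (LieSubalgebra.smul_mem _ _ (sum_mem fun j hj =>
      LieSubalgebra.smul_mem _ _ (xg_mem_lieSpan (Finset.ne_of_mem_erase hj))))
  obtain ⟨E, hE, hEi, hEj⟩ := exists_elementary i (inv_ne_zero hc) hgmem
  have hshift : IsShift (φ * E) (Pi.single i ((c i)⁻¹ • m)) := by
    intro j
    change φ (E (xg K n j)) = _
    by_cases hj : j = i
    · subst hj
      rw [hEi, Pi.single_eq_same, map_add, map_neg, map_smul, map_smul, hφg, h, smul_add, smul_add,
        smul_smul, inv_mul_cancel₀ hc, one_smul, Submodule.coe_smul]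
      abel
    · rw [hEj j hj, hφ j hj, Pi.single_eq_of_ne hj, ZeroMemClass.coe_zero, add_zero]
  have h1 := isTame_of_isShift_single hK ((highSpan K n).smul_mem _ hm) hshift
  have h2 := isTame_mul h1 (isTame_inv (Subgroup.subset_closure hE))
  rwa [mul_inv_cancel_right] at h2

theorem three_ne_zero_of_ringChar (h : ringChar K ≠ 3) : (3 : K) ≠ 0 := by
  intro h3
  have h1 := (ringChar.spec K 3).1 (by exact_mod_cast h3)
  rcases (Nat.dvd_prime Nat.prime_three).1 h1 with h2 | h2
  · exact CharP.ringChar_ne_one h2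
  · exact h h2

end Grading

end Basics

end FreeMetabelianLie

/-- **Theorem 1.** Over a field `K`, with `n ≥ 4` and `char K ≠ 3`, or `n ≥ 5`, every Chein
automorphism of the free metabelian Lie algebra `Mₙ` of lower degree `≥ 4` is tame. -/
theorem chein_aut_ldeg_ge_four_is_tame (K : Type) [Field K] (n : ℕ) (hn : 0 < n)
    (hK : (4 ≤ n ∧ ringChar K ≠ 3) ∨ 5 ≤ n)
    (φ : FreeMetabelianLie K n ≃ₗ⁅K⁆ FreeMetabelianLie K n)
    (hchein : IsCheinAut K n φ) (hdeg : AutLdegGE K n φ 4) :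
    IsTame K n φ := by
  exact FreeMetabelianLie.isTame_of_isCheinAut
    (hK.imp_left fun h => ⟨h.1, FreeMetabelianLie.three_ne_zero_of_ringChar h.2⟩) hchein hdeg
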